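/- Let d ≥ 2 and k ≥ 0 be integers. If a simplex S ∈ S^d(k,1) satisfies vol(S) = (1/d!) · (k+1) · (s_d − 1)^2, then there exists a unimodular transformation φ of ℝ^d with φ(S) = S_{d,k}. -/

import Mathlib

open MeasureTheory ENNReal

noncomputable section

/-- Auxiliary recursion for the Sylvester sequence: `s_{i+1} = s_i (s_i - 1) + 1`,
which is equivalent to `s_i = 1 + s_1 ⋯ s_{i-1}` with `s_1 = 2`. -/
def sylAux : ℕ → ℕ
  | 0 => 2
  | n + 1 => sylAux n * (sylAux n - 1) + 1

/-- The Sylvester sequence `s_1 = 2`, `s_i = 1 + s_1 s_2 ⋯ s_{i-1}` (1-indexed). -/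
def syl (n : ℕ) : ℕ := sylAux (n - 1)

/-- The standard basis vector `e_i` of `ℝ^d`. -/
def stdBasis (d : ℕ) (i : Fin d) : Fin d → ℝ := Pi.single i 1

/-- The integer lattice `ℤ^d`, viewed as a subset of `ℝ^d`. -/
def latticePts (d : ℕ) : Set (Fin d → ℝ) :=
  Set.range fun z : Fin d → ℤ => fun i => (z i : ℝ)

/-- The Zaks–Perles–Wills simplex
`S_{d,k} = conv(0, s_1 e_1, …, s_{d-1} e_{d-1}, (k+1)(s_d - 1) e_d)`. -/
def ZPW (d k : ℕ) : Set (Fin d → ℝ) :=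
  convexHull ℝ (insert 0 (Set.range fun i : Fin d =>
    (if i.1 = d - 1 then ((k : ℝ) + 1) * ((syl d : ℝ) - 1) else (syl (i.1 + 1) : ℝ)) •
      stdBasis d i))

def ILat (ι : Type*) : AddSubgroup (ι → ℝ) where
  carrier := Set.range fun z : ι → ℤ => fun i => (z i : ℝ)
  add_mem' := by
    rintro _ _ ⟨a, rfl⟩ ⟨b, rfl⟩
    exact ⟨a + b, by ext; simp⟩
  zero_mem' := ⟨0, by ext; simp⟩
  neg_mem' := by
    rintro _ ⟨a, rfl⟩
    exact ⟨-a, by ext; simp⟩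

lemma count_of_measure {ι : Type*} [Fintype ι] (K : Set (ι → ℝ)) (hK : MeasurableSet K) (m : ℕ)
    (h : (m : ℝ≥0∞) < volume K) :
    ∃ x : ι → ℝ, ∃ Q : Finset (ι → ℝ), m < Q.card ∧ (∀ q ∈ Q, q ∈ K ∧ q - x ∈ ILat ι) := by
  classical
  have fund := ZSpan.isAddFundamentalDomain' (Pi.basisFun ℝ ι) (volume : Measure (ι → ℝ))
  set F := ZSpan.fundamentalDomain (Pi.basisFun ℝ ι) with hF
  have hvF : volume F = 1 := by
    rw [hF, ZSpan.fundamentalDomain_pi_basisFun]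
    simp [volume_pi_pi]
  set L := (Submodule.span ℤ (Set.range (Pi.basisFun ℝ ι))).toAddSubgroup with hL
  have hmem : ∀ g ∈ L, g ∈ ILat ι := by
    intro g hg
    have : g ∈ Submodule.span ℤ (Set.range (Pi.basisFun ℝ ι)) := hg
    rw [(Pi.basisFun ℝ ι).mem_span_iff_repr_mem ℤ] at this
    choose z hz using this
    exact ⟨z, by ext i; simpa using hz i⟩
  have : Countable L := by
    have h1 : (ILat ι : Set (ι → ℝ)).Countable := Set.countable_range _
    exact (h1.mono hmem).to_subtype
  have key := fund.lintegral_eq_tsum' (K.indicator 1)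
  rw [lintegral_indicator_one hK, ← lintegral_tsum] at key
  · by_contra hcon
    push Not at hcon
    have hb : ∀ x : ι → ℝ, ∑' g : L, K.indicator (1 : (ι → ℝ) → ℝ≥0∞) (-g +ᵥ x) ≤ m := by
      intro x
      rw [ENNReal.tsum_eq_iSup_sum]
      refine iSup_le fun s => ?_
      set Q : Finset (ι → ℝ) := (s.image (fun g : L => (-g +ᵥ x : ι → ℝ))).filter (· ∈ K) with hQ
      have hQc : Q.card ≤ m := by
        by_contra hlt
        obtain ⟨q, hq, hq2⟩ := hcon x Q (not_le.1 hlt)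
        rw [hQ, Finset.mem_filter, Finset.mem_image] at hq
        obtain ⟨⟨g, hg, rfl⟩, hqK⟩ := hq
        apply hq2 hqK
        have : (-g +ᵥ x : ι → ℝ) - x = -(g : ι → ℝ) := by
          simp [AddSubgroup.vadd_def]
        rw [this]
        apply neg_mem
        exact hmem _ g.2
      calc _ = ∑ q ∈ s.image (fun g : L => (-g +ᵥ x : ι → ℝ)), K.indicator (1 : (ι → ℝ) → ℝ≥0∞) q := by
            rw [Finset.sum_image]
            intro a _ b _ hab
            simpa [AddSubgroup.vadd_def] using hab
        _ = (Q.card : ℝ≥0∞) := by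
            rw [hQ, Finset.card_filter]
            push_cast
            refine Finset.sum_congr rfl fun q _ => ?_
            by_cases hq : q ∈ K <;> simp [hq]
        _ ≤ m := by exact_mod_cast hQc
    have : volume K ≤ m := by
      rw [key]
      calc _ ≤ ∫⁻ x in F, (m : ℝ≥0∞) := lintegral_mono fun x => hb x
        _ = m := by simp [hvF]
    exact absurd h (not_lt.2 this)
  · intro g
    refine Measurable.aemeasurable ?_
    exact ((measurable_one.indicator hK).comp (measurable_const_vadd (-g)))

lemma blich {ι : Type*} [Fintype ι] [DecidableEq ι] (M : Matrix ι ι ℝ) (b : ι → ℝ)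
    (hb : ∀ i, 0 < b i) (m : ℕ) (h : (m : ℝ) < |M.det| * ∏ i, b i) :
    ∃ t : Fin (m + 1) → ι → ℝ, Function.Injective t ∧
      (∀ i j, M.mulVec (t i - t j) ∈ ILat ι) ∧ ∀ i j l, |t i l - t j l| < b l := by
  set B : Set (ι → ℝ) := Set.univ.pi fun i => Set.Ico 0 (b i)
  have hdet : M.det ≠ 0 := by
    intro h0
    rw [h0] at h
    simp at h
    have : (0:ℝ) ≤ m := by positivity
    linarith
  have hMu : IsUnit M.det := isUnit_iff_ne_zero.2 hdet
  have hBm : MeasurableSet B := MeasurableSet.univ_pi fun i => measurableSet_Ico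
  have hcont : Continuous (fun x => M⁻¹.mulVec x) := Continuous.matrix_mulVec continuous_const continuous_id
  have hKeq : (fun x => M.mulVec x) '' B = (fun x => M⁻¹.mulVec x) ⁻¹' B := by
    ext x
    constructor
    · rintro ⟨y, hy, rfl⟩
      simpa [Matrix.mulVec_mulVec, Matrix.nonsing_inv_mul _ hMu] using hy
    · intro hx
      exact ⟨_, hx, by simp [Matrix.mulVec_mulVec, Matrix.mul_nonsing_inv _ hMu]⟩
  have hvol : volume ((fun x => M.mulVec x) '' B) = ENNReal.ofReal (|M.det| * ∏ i, b i) := by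
    have := Measure.addHaar_image_linearMap (volume : Measure (ι → ℝ)) (Matrix.toLin' M) B
    rw [LinearMap.det_toLin'] at this
    have h2 : (⇑(Matrix.toLin' M)) = fun x => M.mulVec x := by ext x; simp
    rw [h2] at this
    rw [this, Real.volume_pi_Ico, ENNReal.ofReal_mul (abs_nonneg _), ENNReal.ofReal_prod_of_nonneg (fun i _ => (hb i).le)]
    simp
  obtain ⟨x, Q, hQ, hQ2⟩ := count_of_measure ((fun x => M.mulVec x) '' B)
    (by rw [hKeq]; exact hcont.measurable hBm) m (by
      rw [hvol, ← ENNReal.ofReal_natCast]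
      exact (ENNReal.ofReal_lt_ofReal_iff_of_nonneg (by positivity)).2 h)
  obtain ⟨Q', hQ's, hQ'c⟩ := Finset.exists_subset_card_eq (Nat.succ_le_of_lt hQ)
  let e := Q'.equivFinOfCardEq hQ'c
  have hq : ∀ i : Fin (m+1), ∃ t ∈ B, M.mulVec t = (e.symm i : ι → ℝ) := fun i => by
    have := (hQ2 _ (hQ's (e.symm i).2)).1
    exact this
  choose t ht1 ht2 using hq
  refine ⟨t, ?_, ?_, ?_⟩
  · intro i j hij
    have : (e.symm i : ι → ℝ) = e.symm j := by rw [← ht2, ← ht2, hij]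
    exact e.symm.injective (Subtype.ext this)
  · intro i j
    rw [Matrix.mulVec_sub, ht2, ht2]
    have h1 := (hQ2 _ (hQ's (e.symm i).2)).2
    have h2 := (hQ2 _ (hQ's (e.symm j).2)).2
    have := sub_mem h1 h2
    simpa using this
  · intro i j l
    have h1 := ht1 i l (Set.mem_univ _)
    have h2 := ht1 j l (Set.mem_univ _)
    rw [abs_lt]
    constructor <;> linarith [h1.1, h1.2, h2.1, h2.2]

lemma logmaj (x y : ℕ → ℝ) (j n : ℕ) (hx : ∀ i < n, 0 < x i) (hy : ∀ i < n, 0 < y i)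
    (hanti : ∀ i, i + 1 < n → x (i + 1) ≤ x i)
    (hP : ∀ i, i ≤ n → ∏ l ∈ Finset.Ico j i, x l ≤ ∏ l ∈ Finset.Ico j i, y l) :
    0 ≤ ∑ l ∈ Finset.Ico j n, x l * Real.log (y l / x l) := by
  have key : ∀ i, j ≤ i → i < n → x i * ∑ l ∈ Finset.Ico j (i + 1), Real.log (y l / x l)
      ≤ ∑ l ∈ Finset.Ico j (i + 1), x l * Real.log (y l / x l) := by
    intro i hi
    induction i, hi using Nat.le_induction with
    | base => intro _; simp
    | succ i hi ih =>
      intro hin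
      have ih := ih (by omega)
      rw [Finset.sum_Ico_succ_top (by omega), Finset.sum_Ico_succ_top (b := i + 1) (by omega)]
      have hL : 0 ≤ ∑ l ∈ Finset.Ico j (i + 1), Real.log (y l / x l) := by
        rw [← Real.log_prod]
        · apply Real.log_nonneg
          rw [Finset.prod_div_distrib, le_div_iff₀, one_mul]
          · exact hP _ (by omega)
          · exact Finset.prod_pos fun l hl => hx l (by simp at hl; omega)
        · intro l hl
          simp at hl
          exact (div_pos (hy l (by omega)) (hx l (by omega))).ne'
      have := mul_le_mul_of_nonneg_right (hanti i hin) hL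
      linarith
  rcases lt_or_ge j n with hjn | hjn
  · obtain ⟨m, rfl⟩ : ∃ m, n = m + 1 := ⟨n - 1, by omega⟩
    refine le_trans ?_ (key m (by omega) (by omega))
    refine mul_nonneg (hx m (by omega)).le ?_
    rw [← Real.log_prod]
    · apply Real.log_nonneg
      rw [Finset.prod_div_distrib, le_div_iff₀, one_mul]
      · exact hP _ (by omega)
      · exact Finset.prod_pos fun l hl => hx l (by simp at hl; omega)
    · intro l hl
      simp at hl
      exact (div_pos (hy l (by omega)) (hx l (by omega))).ne'
  · simp [Finset.Ico_eq_empty_of_le hjn]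

lemma term_le {a b : ℝ} (ha : 0 < a) (hb : 0 < b) : a * Real.log (b / a) ≤ b - a := by
  have := Real.log_le_sub_one_of_pos (div_pos hb ha)
  have h2 := mul_le_mul_of_nonneg_left this ha.le
  have : a * (b / a - 1) = b - a := by field_simp
  linarith

lemma term_eq {a b : ℝ} (ha : 0 < a) (hb : 0 < b) (h : b - a ≤ a * Real.log (b / a)) : a = b := by
  by_contra hne
  have h1 : b / a ≠ 1 := by
    intro h1
    rw [div_eq_one_iff_eq ha.ne'] at h1
    exact hne h1.symm
  have := Real.log_lt_sub_one_of_pos (div_pos hb ha) h1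
  have h2 := mul_lt_mul_of_pos_left this ha
  have : a * (b / a - 1) = b - a := by field_simp
  linarith

lemma prodsum_unique (x y : ℕ → ℝ) (n : ℕ) (hx : ∀ i < n, 0 < x i) (hy : ∀ i < n, 0 < y i)
    (hanti : ∀ i, i + 1 < n → x (i + 1) ≤ x i)
    (hxs : ∀ j < n, ∏ l ∈ Finset.range j, x l ≤ ∑ l ∈ Finset.Ico j n, x l)
    (hys : ∀ j < n, ∏ l ∈ Finset.range j, y l = ∑ l ∈ Finset.Ico j n, y l)
    (hsum : ∑ l ∈ Finset.range n, x l = 1)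
    (hP : ∏ l ∈ Finset.range n, x l ≤ ∏ l ∈ Finset.range n, y l) :
    ∀ i < n, x i = y i := by
  have hPx : ∀ j ≤ n, 0 < ∏ l ∈ Finset.range j, x l := fun j hj =>
    Finset.prod_pos fun l hl => hx l (by simp at hl; omega)
  have hPy : ∀ j ≤ n, 0 < ∏ l ∈ Finset.range j, y l := fun j hj =>
    Finset.prod_pos fun l hl => hy l (by simp at hl; omega)
  have step : ∀ m ≤ n, ∀ i, n - m ≤ i → i ≤ n →
      ∏ l ∈ Finset.range i, x l ≤ ∏ l ∈ Finset.range i, y l := by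
    intro m
    induction m with
    | zero =>
      intro _ i h1 h2
      obtain rfl : i = n := by omega
      exact hP
    | succ m ih =>
      intro hm i h1 h2
      have ih := ih (by omega)
      rcases Nat.lt_or_ge (n - (m + 1)) i with hi | hi
      · exact ih i (by omega) h2
      obtain rfl : i = n - (m + 1) := by omega
      set j := n - (m + 1) with hj
      by_contra hlt
      push Not at hlt
      have hmaj := logmaj x y j n hx hy hanti (by
        intro i hi
        rcases Nat.lt_or_ge j i with hji | hji
        · have e1 := Finset.prod_range_mul_prod_Ico x hji.le
          have e2 := Finset.prod_range_mul_prod_Ico y hji.le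
          have h3 := ih i (by omega) hi
          rw [← e1, ← e2] at h3
          have hpos : 0 ≤ ∏ l ∈ Finset.Ico j i, x l := Finset.prod_nonneg fun l hl => (hx l (by simp at hl; omega)).le
          have h4 := mul_le_mul_of_nonneg_right hlt.le hpos
          exact le_of_mul_le_mul_left (h4.trans h3) (hPy j (by omega))
        · simp [Finset.Ico_eq_empty_of_le hji])
      have h5 : ∑ l ∈ Finset.Ico j n, x l * Real.log (y l / x l) ≤ ∑ l ∈ Finset.Ico j n, (y l - x l) :=
        Finset.sum_le_sum fun l hl => term_le (hx l (by simp at hl; omega)) (hy l (by simp at hl; omega))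
      rw [Finset.sum_sub_distrib] at h5
      have h6 := hxs j (by omega)
      have h7 := hys j (by omega)
      linarith
  have all := step n le_rfl
  intro i hi
  have hmaj := logmaj x y 0 n hx hy hanti (by
    intro i hi
    simpa using all i (by omega) hi)
  have h7 := hys 0 (by omega)
  rw [← Finset.range_eq_Ico] at hmaj h7
  simp only [Finset.range_zero, Finset.prod_empty] at h7
  apply term_eq (hx i hi) (hy i hi)
  by_contra hlt
  push Not at hlt
  have h5 : ∑ l ∈ Finset.range n, x l * Real.log (y l / x l) < ∑ l ∈ Finset.range n, (y l - x l) :=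
    Finset.sum_lt_sum (fun l hl => term_le (hx l (by simp at hl; omega)) (hy l (by simp at hl; omega)))
      ⟨i, by simpa using hi, hlt⟩
  rw [Finset.sum_sub_distrib] at h5
  linarith

lemma sylAux_ge (n : ℕ) : 2 ≤ sylAux n := by
  induction n with
  | zero => simp [sylAux]
  | succ n ih =>
    rw [sylAux]
    have : 1 ≤ sylAux n - 1 := by omega
    nlinarith

lemma sylAux_prod (n : ℕ) : ∏ l ∈ Finset.range n, sylAux l = sylAux n - 1 := by
  induction n with
  | zero => simp [sylAux]
  | succ n ih => rw [Finset.prod_range_succ, ih, sylAux, Nat.add_sub_cancel, mul_comm]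

lemma sylAux_prod_real (n : ℕ) : ∏ l ∈ Finset.range n, (sylAux l : ℝ) = sylAux n - 1 := by
  have h := congrArg (Nat.cast (R := ℝ)) (sylAux_prod n)
  have := sylAux_ge n
  rw [Nat.cast_sub (by omega)] at h
  push_cast at h
  exact h

lemma sylAux_coprime {i j : ℕ} (h : i ≠ j) : Nat.Coprime (sylAux i) (sylAux j) := by
  wlog hij : i < j generalizing i j
  · exact (this h.symm (by omega)).symm
  have h1 : sylAux i ∣ sylAux j - 1 := by
    rw [← sylAux_prod]
    exact Finset.dvd_prod_of_mem _ (by simpa using hij)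
  have h2 := sylAux_ge j
  have : Nat.Coprime (sylAux j - 1) (sylAux j) := by
    have : Nat.Coprime (sylAux j - 1) (sylAux j - 1 + 1) := by simp
    rwa [Nat.sub_add_cancel (by omega)] at this
  exact Nat.Coprime.coprime_dvd_left h1 this

/-- the extremal barycentric coordinates in dimension `n` (n+1 entries) -/
def ySeq (n i : ℕ) : ℝ := if i < n then 1 / (sylAux i : ℝ) else 1 / ((sylAux n : ℝ) - 1)

lemma sylAux_real (n : ℕ) : (2 : ℝ) ≤ sylAux n := by exact_mod_cast sylAux_ge n

lemma ySeq_pos (n i : ℕ) : 0 < ySeq n i := by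
  unfold ySeq
  have h1 := sylAux_real i
  have h2 := sylAux_real n
  split_ifs
  · apply one_div_pos.2; linarith
  · apply one_div_pos.2; linarith

lemma ySeq_prod (n j : ℕ) (hj : j ≤ n) : ∏ l ∈ Finset.range j, ySeq n l = 1 / ((sylAux j : ℝ) - 1) := by
  rw [← sylAux_prod_real, one_div, ← Finset.prod_inv_distrib]
  refine Finset.prod_congr rfl fun l hl => ?_
  simp at hl
  simp [ySeq, show l < n by omega]

lemma ySeq_sum (n j : ℕ) (hj : j ≤ n) :
    1 / ((sylAux j : ℝ) - 1) = ∑ l ∈ Finset.Ico j (n + 1), ySeq n l := by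
  induction hj using Nat.decreasingInduction with
  | self => simp [ySeq]
  | of_succ j hj ih =>
    rw [Finset.sum_eq_sum_Ico_succ_bot (by omega), ← ih]
    have h := sylAux_real j
    have hn : sylAux (j + 1) = sylAux j * (sylAux j - 1) + 1 := rfl
    have h2 : (sylAux (j + 1) : ℝ) = sylAux j * (sylAux j - 1) + 1 := by
      rw [hn]
      push_cast [Nat.cast_sub (show 1 ≤ sylAux j by linarith [sylAux_ge j])]
      ring
    rw [h2]
    simp only [ySeq, hj, if_true]
    have h3 : (sylAux j : ℝ) - 1 ≠ 0 := by linarith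
    have h4 : (sylAux j : ℝ) ≠ 0 := by linarith
    rw [add_sub_cancel_right]
    field_simp
    ring

lemma syl_unique (n : ℕ) (x : ℕ → ℝ) (hx : ∀ i < n + 1, 0 < x i)
    (hanti : ∀ i, i + 1 < n + 1 → x (i + 1) ≤ x i)
    (hxs : ∀ j < n + 1, ∏ l ∈ Finset.range j, x l ≤ ∑ l ∈ Finset.Ico j (n + 1), x l)
    (hsum : ∑ l ∈ Finset.range (n + 1), x l = 1)
    (hP : (∏ l ∈ Finset.range (n + 1), x l) * ((sylAux n : ℝ) - 1) ^ 2 ≤ 1) :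
    ∀ i < n + 1, x i = ySeq n i := by
  apply prodsum_unique x (ySeq n) (n + 1) hx (fun i _ => ySeq_pos n i) hanti hxs
    (fun j hj => by rw [ySeq_prod n j (by omega), ySeq_sum n j (by omega)]) hsum
  rw [Finset.prod_range_succ _ n, Finset.prod_range_succ _ n, ySeq_prod n n le_rfl]
  rw [Finset.prod_range_succ] at hP
  have h2 := sylAux_real n
  have h3 : (sylAux n : ℝ) - 1 > 0 := by linarith
  simp only [ySeq, lt_irrefl, if_false]
  rw [div_mul_div_comm, le_div_iff₀ (by positivity)]
  calc _ = _ := by ring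
    _ ≤ 1 := hP
    _ = _ := by ring

lemma simplexVol (n : ℕ) : ∀ r : ℝ, 0 ≤ r →
    volume {x : Fin n → ℝ | (∀ i, 0 ≤ x i) ∧ ∑ i, x i ≤ r} = ENNReal.ofReal (r ^ n / n.factorial) := by
  induction n with
  | zero =>
    intro r hr
    have : {x : Fin 0 → ℝ | (∀ i, 0 ≤ x i) ∧ ∑ i, x i ≤ r} = Set.univ := by
      ext x; simp [hr]
    rw [this, volume_pi, Measure.pi_univ]
    simp
  | succ n ih =>
    intro r hr
    have hmp := (MeasureTheory.volume_preserving_piFinSuccAbove (fun _ : Fin (n + 1) => ℝ) 0).symm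
    set T := {x : Fin (n + 1) → ℝ | (∀ i, 0 ≤ x i) ∧ ∑ i, x i ≤ r} with hT
    have hTc : MeasurableSet T := by
      have : T = (⋂ i, {x | 0 ≤ x i}) ∩ {x | ∑ i, x i ≤ r} := by
        ext x; simp [hT]
      rw [this]
      apply MeasurableSet.inter
      · exact MeasurableSet.iInter fun i => measurableSet_le measurable_const (measurable_pi_apply i)
      · exact measurableSet_le (Finset.measurable_sum _ fun i _ => measurable_pi_apply i) measurable_const
    rw [← hmp.measure_preimage hTc.nullMeasurableSet, Measure.volume_eq_prod,
      Measure.prod_apply (hmp.measurable hTc)]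
    have hslice : ∀ t : ℝ, volume (Prod.mk t ⁻¹' ((MeasurableEquiv.piFinSuccAbove (fun _ : Fin (n + 1) => ℝ) 0).symm ⁻¹' T))
        = (Set.Icc 0 r).indicator (fun t => ENNReal.ofReal ((r - t) ^ n / n.factorial)) t := by
      intro t
      have hset : (Prod.mk t ⁻¹' ((MeasurableEquiv.piFinSuccAbove (fun _ : Fin (n + 1) => ℝ) 0).symm ⁻¹' T))
          = {x : Fin n → ℝ | 0 ≤ t ∧ (∀ i, 0 ≤ x i) ∧ ∑ i, x i ≤ r - t} := by
        ext x
        simp only [hT, Set.mem_preimage, Set.mem_ofPred_eq, MeasurableEquiv.piFinSuccAbove_symm_apply]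
        rw [Fin.forall_fin_succ, Fin.sum_univ_succ]
        simp [le_sub_iff_add_le', and_assoc]
      rw [hset]
      by_cases ht : t ∈ Set.Icc 0 r
      · rw [Set.indicator_of_mem ht, ← ih (r - t) (by linarith [ht.2])]
        simp [ht.1]
      · rw [Set.indicator_of_notMem ht]
        convert measure_empty
        · ext x
          simp only [Set.mem_ofPred_eq, Set.mem_empty_iff_false, iff_false]
          rintro ⟨h0, h1, h2⟩
          have : 0 ≤ ∑ i, x i := Finset.sum_nonneg fun i _ => h1 i
          exact ht ⟨h0, by linarith⟩
        · infer_instance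
    simp_rw [hslice]
    rw [lintegral_indicator measurableSet_Icc, ← ofReal_integral_eq_lintegral_ofReal]
    · congr 1
      rw [integral_Icc_eq_integral_Ioc, ← intervalIntegral.integral_of_le hr]
      rw [intervalIntegral.integral_comp_sub_left (fun u => u ^ n / (n.factorial : ℝ)) r]
      simp [integral_pow, Nat.factorial_succ]
      field_simp
    · exact (Continuous.integrableOn_Icc (by fun_prop))
    · filter_upwards [ae_restrict_mem measurableSet_Icc] with t ht
      have : 0 ≤ r - t := by linarith [ht.2]
      positivity

lemma convexHull_eq_image {d : ℕ} (b : Fin d → ℝ) (c : Fin d → Fin d → ℝ) :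
    convexHull ℝ (insert b (Set.range c)) =
      (fun x => b + (Matrix.of fun l i => c i l - b l).mulVec x) ''
        {x : Fin d → ℝ | (∀ i, 0 ≤ x i) ∧ ∑ i, x i ≤ 1} := by
  have hfun : ∀ x : Fin d → ℝ, b + (Matrix.of fun l i => c i l - b l).mulVec x = b + ∑ i, x i • (c i - b) := by
    intro x
    ext l
    simp [Matrix.mulVec, dotProduct, Finset.sum_apply, mul_comm]
  simp_rw [hfun]
  apply Set.Subset.antisymm
  · apply convexHull_min
    · rintro _ (rfl | ⟨i, rfl⟩)
      · exact ⟨0, by simp, by simp⟩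
      · refine ⟨Pi.single i 1, ⟨fun j => ?_, by simp⟩, ?_⟩
        · by_cases h : j = i
          · subst h; simp
          · simp [h]
        · simp only
          rw [Finset.sum_eq_single i]
          · simp
          · intro j _ hj; simp [hj]
          · simp
    · rintro _ ⟨x, ⟨hx, hx1⟩, rfl⟩ _ ⟨y, ⟨hy, hy1⟩, rfl⟩ s t hs ht hst
      refine ⟨s • x + t • y, ⟨fun i => ?_, ?_⟩, ?_⟩
      · have := mul_nonneg hs (hx i)
        have := mul_nonneg ht (hy i)
        simp; linarith
      · simp only [Pi.add_apply, Pi.smul_apply, smul_eq_mul, Finset.sum_add_distrib, ← Finset.mul_sum]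
        nlinarith
      · have : b = s • b + t • b := by rw [← add_smul, hst, one_smul]
        simp only [Pi.add_apply, Pi.smul_apply, smul_eq_mul, add_smul, Finset.sum_add_distrib, mul_smul,
          ← Finset.smul_sum, smul_add]
        nth_rewrite 1 [this]
        abel
  · rintro _ ⟨x, ⟨hx, hx1⟩, rfl⟩
    have h0 : b ∈ convexHull ℝ (insert b (Set.range c)) := subset_convexHull _ _ (Set.mem_insert _ _)
    have hc : ∀ i, c i ∈ convexHull ℝ (insert b (Set.range c)) := fun i =>
      subset_convexHull _ _ (Set.mem_insert_of_mem _ ⟨i, rfl⟩)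
    have : b + ∑ i, x i • (c i - b) = ∑ o : Option (Fin d), (o.elim (1 - ∑ i, x i) x) • (o.elim b c) := by
      rw [Fintype.sum_option]
      simp only [Option.elim, smul_sub, Finset.sum_sub_distrib, ← Finset.sum_smul, sub_smul, one_smul]
      abel
    simp only
    rw [this]
    apply (convex_convexHull ℝ _).sum_mem
    · rintro (_ | i) _
      · simpa using hx1
      · exact hx i
    · rw [Fintype.sum_option]; simp
    · rintro (_ | i) _
      · exact h0
      · exact hc i

lemma volume_simplex {d : ℕ} (b : Fin d → ℝ) (c : Fin d → Fin d → ℝ) :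
    volume (convexHull ℝ (insert b (Set.range c))) =
      ENNReal.ofReal (|(Matrix.of fun l i => c i l - b l).det| / d.factorial) := by
  rw [convexHull_eq_image]
  set M : Matrix (Fin d) (Fin d) ℝ := (Matrix.of fun l i => c i l - b l)
  set T := {x : Fin d → ℝ | (∀ i, 0 ≤ x i) ∧ ∑ i, x i ≤ 1} with hT
  have h1 : (fun x => b + M.mulVec x) '' T = (fun x => b + x) '' ((Matrix.toLin' M) '' T) := by
    rw [Set.image_image]; simp
  rw [h1, Set.image_add_left, measure_preimage_add, Measure.addHaar_image_linearMap, LinearMap.det_toLin',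
    hT, simplexVol d 1 zero_le_one, ← ENNReal.ofReal_mul (abs_nonneg _)]
  congr 1
  simp [div_eq_mul_inv]

lemma prodsum {d : ℕ} (w : Fin d → Fin d → ℝ) (hw : ∀ i, w i ∈ ILat (Fin d)) (β : Fin d → ℝ)
    (hβ : ∀ i, 0 < β i) (hβ1 : ∑ i, β i = 1) (hp : ∑ i, β i • w i ∈ ILat (Fin d))
    (hU : ∀ c : Fin d → ℝ, (∀ i, 0 < c i) → ∑ i, c i = 1 → ∑ i, c i • w i ∈ ILat (Fin d) → c = β)
    (J : Finset (Fin d)) (hJ : ∃ i, i ∉ J) : ∏ i ∈ J, β i ≤ ∑ i ∈ Jᶜ, β i := by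
  classical
  by_contra hlt
  push Not at hlt
  have hT : 0 < ∑ i ∈ Jᶜ, β i := by
    obtain ⟨i, hi⟩ := hJ
    exact Finset.sum_pos (fun i _ => hβ i) ⟨i, by simpa using hi⟩
  have hsplit : ∑ i ∈ J, β i + ∑ i ∈ Jᶜ, β i = 1 := by rw [Finset.sum_add_sum_compl, hβ1]
  let A : Matrix (J ⊕ Unit) (J ⊕ Unit) ℝ :=
    Matrix.fromBlocks 1 (Matrix.of fun i _ => β i) (Matrix.of fun _ _ => 1) 1
  have hdetA : A.det = ∑ i ∈ Jᶜ, β i := by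
    simp only [A, Matrix.det_fromBlocks_one₁₁]
    rw [Matrix.det_unique]
    simp [Matrix.mul_apply]
    rw [Finset.sum_attach J β]
    linarith
  have hAu : IsUnit A.det := isUnit_iff_ne_zero.2 (by rw [hdetA]; exact hT.ne')
  obtain ⟨t, htinj, htL, htb⟩ := blich A⁻¹ (Sum.elim (fun i : J => β i) (fun _ => 1)) (by
      rintro (i | i)
      · exact hβ i
      · exact one_pos) 1 (by
      rw [Matrix.det_nonsing_inv, Ring.inverse_eq_inv', hdetA, abs_of_pos (inv_pos.2 hT), Fintype.prod_sum_type]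
      simp only [Sum.elim_inl, Sum.elim_inr, Finset.prod_const_one, mul_one]
      rw [Finset.prod_coe_sort J β, inv_mul_eq_div]
      rw [lt_div_iff₀ hT]
      simpa using hlt)
  obtain ⟨z, hz⟩ := htL 0 1
  set τ := t 0 - t 1 with hτ
  have hτ0 : τ ≠ 0 := by
    intro h0
    have := htinj (sub_eq_zero.1 h0)
    simp at this
  have hAz : A.mulVec (fun i => (z i : ℝ)) = τ := by
    rw [show (fun i => (z i : ℝ)) = A⁻¹.mulVec τ from hz, Matrix.mulVec_mulVec, Matrix.mul_nonsing_inv _ hAu, Matrix.one_mulVec]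
  have hA1 : ∀ i : J, (z (Sum.inl i) : ℝ) + β i * z (Sum.inr ()) = τ (Sum.inl i) := by
    intro i
    rw [← hAz]
    simp [A, Matrix.mulVec, dotProduct, Matrix.one_apply]
  have hA2 : (∑ i : J, (z (Sum.inl i) : ℝ)) + z (Sum.inr ()) = τ (Sum.inr ()) := by
    rw [← hAz]
    simp [A, Matrix.mulVec, dotProduct, Matrix.one_apply]
  have hb1 : ∀ i : J, |τ (Sum.inl i)| < β i := fun i => htb 0 1 (Sum.inl i)
  have hb2 : |τ (Sum.inr ())| < 1 := htb 0 1 (Sum.inr ())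
  have hz0 : (∑ i : J, z (Sum.inl i)) + z (Sum.inr ()) = 0 := by
    rw [← hA2] at hb2
    have : |(∑ i : J, z (Sum.inl i)) + z (Sum.inr ())| < 1 := by exact_mod_cast hb2
    rwa [Int.abs_lt_one_iff] at this
  have hβlt : ∀ i, β i ≤ 1 := fun i => by
    rw [← hβ1]; exact Finset.single_le_sum (fun i _ => (hβ i).le) (Finset.mem_univ i)
  have hMne : z (Sum.inr ()) ≠ 0 := by
    intro h0
    apply hτ0
    rw [← hAz]
    have : z = 0 := by
      ext i
      rcases i with i | i
      · have h1 := hb1 i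
        rw [← hA1 i, h0] at h1
        have h2 : |(z (Sum.inl i) : ℝ)| < 1 := by
          have := hβlt i
          simp at h1; linarith
        have h3 : |z (Sum.inl i)| < 1 := by exact_mod_cast h2
        rw [Int.abs_lt_one_iff] at h3
        exact h3
      · exact h0
    rw [this]
    ext; simp [Matrix.mulVec, dotProduct]
  -- the construction for a positive multiplier
  have fin : ∀ (m : ℤ) (n : J → ℤ), 0 < m → (∑ i, n i) + m = 0 →
      (∀ i : J, |(n i : ℝ) + β i * m| < β i) → False := by
    intro m n hm hs hbd
    let c : Fin d → ℝ := fun i => (1 + m) * β i + (if h : i ∈ J then (n ⟨i, h⟩ : ℝ) else 0)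
    have hmr : (0:ℝ) < m := by exact_mod_cast hm
    have hsn : ∑ i, (if h : i ∈ J then (n ⟨i, h⟩ : ℝ) else 0) = ∑ i : J, (n i : ℝ) := by
      rw [Finset.sum_dite]
      simp
      apply Finset.sum_bij' (fun a _ => ⟨a.1, by simpa using a.2⟩) (fun a _ => ⟨a.1, by simp⟩) <;> simp
    have hcU := hU c ?_ ?_ ?_
    · obtain ⟨i, hi⟩ := hJ
      have := congrFun hcU i
      simp only [c, hi, dif_neg, not_false_iff] at this
      have := hβ i
      nlinarith
    · intro i
      have h0 := hβ i
      by_cases hi : i ∈ J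
      · simp only [c, hi, dif_pos]
        have := (abs_lt.1 (hbd ⟨i, hi⟩)).1
        simp only at this
        linarith
      · simp only [c, hi, dif_neg, not_false_iff]
        nlinarith
    · simp only [c, Finset.sum_add_distrib, ← Finset.mul_sum, hβ1, hsn]
      have : ((∑ i, n i : ℤ) : ℝ) + m = 0 := by exact_mod_cast hs
      push_cast at this
      linarith
    · have e : ∑ i, c i • w i = (1 + m) • ∑ i, β i • w i
          + ∑ i, (if h : i ∈ J then n ⟨i, h⟩ else 0) • w i := by
        rw [Finset.smul_sum, ← Finset.sum_add_distrib]
        refine Finset.sum_congr rfl fun i _ => ?_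
        ext l
        by_cases hi : i ∈ J <;> simp [c, hi] <;> ring
      rw [e]
      exact add_mem (zsmul_mem hp _) (sum_mem fun i _ => zsmul_mem (hw i) _)
  rcases lt_or_gt_of_ne hMne with hneg | hpos
  · refine fin (-z (Sum.inr ())) (fun i => -z (Sum.inl i)) (by omega) (by rw [Finset.sum_neg_distrib]; omega) ?_
    intro i
    have := hb1 i
    rw [← hA1 i, ← abs_neg] at this
    convert this using 2
    push_cast; ring
  · refine fin (z (Sum.inr ())) (fun i => z (Sum.inl i)) hpos hz0 ?_
    intro i
    rw [hA1 i]; exact hb1 i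

lemma wpoint {d : ℕ} (w : Fin d → Fin d → ℝ) (a x : Fin d → ℝ) :
    (Matrix.of fun l i => w i l - a l).mulVec x = ∑ i, x i • (w i - a) := by
  ext l
  simp [Matrix.mulVec, dotProduct, Finset.sum_apply, mul_comm]

lemma volbound {d k : ℕ} (w : Fin d → Fin d → ℝ) (a : Fin d → ℝ) (β : Fin d → ℝ)
    (hβ : ∀ i, 0 < β i) (hβ1 : ∑ i, β i = 1) (hp : ∑ i, β i • w i ∈ ILat (Fin d))
    (hU : ∀ c : Fin d → ℝ, (∀ i, 0 < c i) → ∑ i, c i = 1 → ∑ i, c i • w i ∈ ILat (Fin d) → c = β)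
    (hI : ∀ Q : Finset (Fin d → ℝ), (∀ c ∈ Q, (∀ i, 0 < c i) ∧ ∑ i, c i < 1 ∧
      a + ∑ i, c i • (w i - a) ∈ ILat (Fin d)) → Q.card ≤ k) :
    |(Matrix.of fun l i => w i l - a l).det| * ∏ i, β i ≤ k + 1 := by
  classical
  by_contra hlt
  push Not at hlt
  obtain ⟨t, htinj, htL, htb⟩ := blich (Matrix.of fun l i => w i l - a l) β hβ (k + 1) (by
    push_cast; exact hlt)
  obtain ⟨m, -, hm⟩ := Finset.exists_max_image (Finset.univ : Finset (Fin (k + 1 + 1))) (fun i => ∑ l, t i l)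
    ⟨0, Finset.mem_univ _⟩
  let Q : Finset (Fin d → ℝ) := (Finset.univ.erase m).image (fun i => β + (t i - t m))
  have hQc : Q.card = k + 1 := by
    rw [Finset.card_image_of_injective]
    · simp
    · intro i j hij
      simp at hij
      exact htinj hij
  have := hI Q ?_
  · omega
  intro c hc
  simp only [Q, Finset.mem_image, Finset.mem_erase, Finset.mem_univ, and_true] at hc
  obtain ⟨i, him, rfl⟩ := hc
  have hpos : ∀ l, 0 < (β + (t i - t m)) l := fun l => by
    have := (abs_lt.1 (htb i m l)).1
    simp only [Pi.add_apply, Pi.sub_apply]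
    linarith
  have hsum : ∑ l, (β + (t i - t m)) l = 1 + (∑ l, t i l - ∑ l, t m l) := by
    simp only [Pi.add_apply, Pi.sub_apply, Finset.sum_add_distrib, Finset.sum_sub_distrib, hβ1]
  have hmem : a + ∑ l, (β + (t i - t m)) l • (w l - a) ∈ ILat (Fin d) := by
    have h1 := htL i m
    rw [wpoint] at h1
    have h2 := add_mem hp h1
    convert h2 using 1
    have : ∑ l, β l • (w l - a) = ∑ l, β l • w l - a := by
      simp only [smul_sub, Finset.sum_sub_distrib, ← Finset.sum_smul, hβ1, one_smul]
    simp only [Pi.add_apply, add_smul, Finset.sum_add_distrib, this]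
    abel
  refine ⟨hpos, ?_, hmem⟩
  have hle := hm i (Finset.mem_univ _)
  rcases lt_or_eq_of_le hle with h | h
  · rw [hsum]; linarith
  · exfalso
    have hs1 : ∑ l, (β + (t i - t m)) l = 1 := by rw [hsum]; linarith
    have := hU _ hpos hs1 (by
      convert hmem using 1
      simp only [smul_sub, Finset.sum_sub_distrib, ← Finset.sum_smul, hs1, one_smul]
      abel)
    apply him
    apply htinj
    have h3 : t i - t m = 0 := by simpa using this
    exact sub_eq_zero.1 h3

/-- simplex coordinates -/
def psi {d : ℕ} (w : Fin d → Fin d → ℝ) (a x : Fin d → ℝ) : Fin d → ℝ :=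
  (Matrix.of fun l i => w i l - a l)⁻¹.mulVec (x - a)

lemma psi_cont {d : ℕ} (w : Fin d → Fin d → ℝ) (a : Fin d → ℝ) : Continuous (psi w a) :=
  Continuous.matrix_mulVec continuous_const (continuous_id.sub continuous_const)

lemma psi_aff {d : ℕ} (w : Fin d → Fin d → ℝ) (a u v x : Fin d → ℝ) (s : ℝ) :
    psi w a (s • (u - v) + x) = s • (psi w a u - psi w a v) + psi w a x := by
  unfold psi
  rw [← Matrix.mulVec_sub, ← Matrix.mulVec_smul, ← Matrix.mulVec_add]
  congr 1
  rw [sub_sub_sub_cancel_right]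
  abel

lemma psi_spec {d : ℕ} (w : Fin d → Fin d → ℝ) (a : Fin d → ℝ)
    (hdet : (Matrix.of fun l i => w i l - a l).det ≠ 0) (x : Fin d → ℝ) :
    a + ∑ i, psi w a x i • (w i - a) = x := by
  rw [← wpoint]
  unfold psi
  rw [Matrix.mulVec_mulVec, Matrix.mul_nonsing_inv _ (isUnit_iff_ne_zero.2 hdet), Matrix.one_mulVec]
  abel

lemma psi_point {d : ℕ} (w : Fin d → Fin d → ℝ) (a : Fin d → ℝ)
    (hdet : (Matrix.of fun l i => w i l - a l).det ≠ 0) (c : Fin d → ℝ) :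
    psi w a (a + ∑ i, c i • (w i - a)) = c := by
  rw [← wpoint]
  unfold psi
  rw [add_sub_cancel_left, Matrix.mulVec_mulVec, Matrix.nonsing_inv_mul _ (isUnit_iff_ne_zero.2 hdet), Matrix.one_mulVec]

lemma sum_one_point {d : ℕ} (w : Fin d → Fin d → ℝ) (a : Fin d → ℝ) (c : Fin d → ℝ) (hc : ∑ i, c i = 1) :
    a + ∑ i, c i • (w i - a) = ∑ i, c i • w i := by
  simp only [smul_sub, Finset.sum_sub_distrib, ← Finset.sum_smul, hc, one_smul]
  abel

lemma psi_vertex {d : ℕ} (w : Fin d → Fin d → ℝ) (a : Fin d → ℝ)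
    (hdet : (Matrix.of fun l i => w i l - a l).det ≠ 0) (i : Fin d) :
    psi w a (w i) = Pi.single i 1 := by
  have := psi_point w a hdet (Pi.single i 1)
  rw [sum_one_point _ _ _ (by simp)] at this
  rw [← this]
  congr 1
  rw [Finset.sum_eq_single i]
  · simp
  · intro j _ hj; simp [hj]
  · simp

lemma mem_facet {d : ℕ} (w : Fin d → Fin d → ℝ) (c : Fin d → ℝ) (hc : ∀ i, 0 ≤ c i)
    (hc1 : ∑ i, c i = 1) : ∑ i, c i • w i ∈ convexHull ℝ (Set.range w) :=
  (convex_convexHull ℝ _).sum_mem (fun i _ => hc i) hc1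
    (fun i _ => subset_convexHull ℝ _ ⟨i, rfl⟩)

lemma facet_psi {d : ℕ} (w : Fin d → Fin d → ℝ) (a : Fin d → ℝ)
    (hdet : (Matrix.of fun l i => w i l - a l).det ≠ 0) {x : Fin d → ℝ}
    (hx : x ∈ convexHull ℝ (Set.range w)) : ∀ i, 0 ≤ psi w a x i := by
  have : convexHull ℝ (Set.range w) ⊆ {x | ∀ i, 0 ≤ psi w a x i} := by
    apply convexHull_min
    · rintro _ ⟨j, rfl⟩ i
      rw [psi_vertex w a hdet]
      by_cases h : i = j
      · subst h; simp
      · simp [h]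
    · intro u hu v hv s t hs ht hst i
      have e : s • u + t • v = t • (v - u) + u := by
        rw [show s = 1 - t by linarith]; module
      rw [e, psi_aff]
      have h1 := mul_nonneg hs (hu i)
      have h2 := mul_nonneg ht (hv i)
      simp only [Pi.add_apply, Pi.smul_apply, Pi.sub_apply, smul_eq_mul]
      have : s = 1 - t := by linarith
      subst this
      linarith
  exact this hx

lemma span_psi {d : ℕ} (w : Fin d → Fin d → ℝ) (a : Fin d → ℝ)
    (hdet : (Matrix.of fun l i => w i l - a l).det ≠ 0) {x : Fin d → ℝ}
    (hx : x ∈ affineSpan ℝ (convexHull ℝ (Set.range w))) : ∑ i, psi w a x i = 1 := by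
  rw [affineSpan_convexHull] at hx
  refine affineSpan_induction hx ?_ ?_
  · rintro _ ⟨j, rfl⟩
    rw [psi_vertex w a hdet]
    simp
  · intro s u v y hu hv hy
    rw [vsub_eq_sub, vadd_eq_add, psi_aff]
    simp [Finset.sum_add_distrib, ← Finset.mul_sum, hu, hv, hy]

lemma relint_of_pos {d : ℕ} (w : Fin d → Fin d → ℝ) (a : Fin d → ℝ)
    (hdet : (Matrix.of fun l i => w i l - a l).det ≠ 0) (c : Fin d → ℝ) (hc : ∀ i, 0 < c i)
    (hc1 : ∑ i, c i = 1) :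
    ∑ i, c i • w i ∈ intrinsicInterior ℝ (convexHull ℝ (Set.range w)) := by
  rw [mem_intrinsicInterior]
  have hmem := mem_facet w c (fun i => (hc i).le) hc1
  refine ⟨⟨_, subset_affineSpan ℝ _ hmem⟩, ?_, rfl⟩
  rw [mem_interior]
  refine ⟨{y | ∀ i, 0 < psi w a (y : Fin d → ℝ) i}, ?_, ?_, ?_⟩
  · intro y hy
    have h1 := span_psi w a hdet y.2
    have h2 := psi_spec w a hdet y
    rw [sum_one_point _ _ _ h1] at h2
    show (y : Fin d → ℝ) ∈ convexHull ℝ (Set.range w)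
    rw [← h2]
    exact mem_facet w _ (fun i => (hy i).le) h1
  · rw [Set.ofPred_forall]
    refine isOpen_iInter_of_finite fun i => ?_
    exact isOpen_lt continuous_const ((continuous_apply i).comp ((psi_cont w a).comp continuous_subtype_val))
  · intro i
    show 0 < psi w a (∑ i, c i • w i) i
    rw [← sum_one_point w a c hc1, psi_point w a hdet]
    exact hc i

lemma pos_of_relint {d : ℕ} (w : Fin d → Fin d → ℝ) (a : Fin d → ℝ)
    (hdet : (Matrix.of fun l i => w i l - a l).det ≠ 0) (x : Fin d → ℝ)
    (hx : x ∈ intrinsicInterior ℝ (convexHull ℝ (Set.range w))) :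
    (∀ i, 0 < psi w a x i) ∧ ∑ i, psi w a x i = 1 := by
  rw [mem_intrinsicInterior] at hx
  obtain ⟨y, hy, rfl⟩ := hx
  refine ⟨fun i => ?_, span_psi w a hdet y.2⟩
  have hyF : (y : Fin d → ℝ) ∈ convexHull ℝ (Set.range w) := by
    have := interior_subset hy
    exact this
  rcases lt_or_eq_of_le (facet_psi w a hdet hyF i) with h | h
  · exact h
  exfalso
  have hwi : w i ∈ affineSpan ℝ (convexHull ℝ (Set.range w)) :=
    subset_affineSpan ℝ _ (subset_convexHull ℝ _ ⟨i, rfl⟩)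
  let γ : ℝ → affineSpan ℝ (convexHull ℝ (Set.range w)) := fun s =>
    ⟨s • ((y : Fin d → ℝ) - w i) + y, by
      have := AffineSubspace.smul_vsub_vadd_mem _ s y.2 hwi y.2
      simpa using this⟩
  have hγ : Continuous γ := by
    apply Continuous.subtype_mk
    fun_prop
  have hγ0 : γ 0 = y := by ext; simp [γ]
  have hev : ∀ᶠ s in nhds (0:ℝ), γ s ∈ ((↑) ⁻¹' (convexHull ℝ (Set.range w)) : Set (affineSpan ℝ (convexHull ℝ (Set.range w)))) := by
    apply hγ.continuousAt.eventually_mem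
    rw [hγ0]
    exact mem_interior_iff_mem_nhds.1 hy
  obtain ⟨ε, hε, hball⟩ := Metric.eventually_nhds_iff.1 hev
  have h2 := hball (y := ε / 2) (by rw [Real.dist_eq, sub_zero, abs_of_pos (by linarith)]; linarith)
  have h3 := facet_psi w a hdet h2 i
  simp only [γ] at h3
  rw [psi_aff, psi_vertex w a hdet] at h3
  simp only [Pi.add_apply, Pi.smul_apply, Pi.sub_apply, smul_eq_mul, ← h, Pi.single_eq_same] at h3
  linarith

lemma interior_of_pos {d : ℕ} (w : Fin d → Fin d → ℝ) (a : Fin d → ℝ)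
    (hdet : (Matrix.of fun l i => w i l - a l).det ≠ 0) (c : Fin d → ℝ) (hc : ∀ i, 0 < c i)
    (hc1 : ∑ i, c i < 1) :
    a + ∑ i, c i • (w i - a) ∈ interior (convexHull ℝ (insert a (Set.range w))) := by
  rw [mem_interior]
  refine ⟨{y | ∀ i, 0 < psi w a y i} ∩ {y | ∑ i, psi w a y i < 1}, ?_, ?_, ?_⟩
  · rintro y ⟨h1, h2⟩
    rw [convexHull_eq_image]
    refine ⟨psi w a y, ⟨fun i => (h1 i).le, le_of_lt h2⟩, ?_⟩
    simp only
    rw [wpoint, psi_spec w a hdet]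
  · apply IsOpen.inter
    · rw [Set.ofPred_forall]
      refine isOpen_iInter_of_finite fun i => ?_
      exact isOpen_lt continuous_const ((continuous_apply i).comp (psi_cont w a))
    · exact isOpen_lt (continuous_finsetSum _ fun i _ => (continuous_apply i).comp (psi_cont w a)) continuous_const
  · refine ⟨fun i => ?_, ?_⟩
    · rw [psi_point w a hdet]; exact hc i
    · show ∑ i, psi w a (a + ∑ i, c i • (w i - a)) i < 1
      rw [psi_point w a hdet]; exact hc1

lemma lat_finite {d : ℕ} (K : Set (Fin d → ℝ)) (hK : Bornology.IsBounded K) : (latticePts d ∩ K).Finite := by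
  obtain ⟨R, hR⟩ := hK.subset_closedBall 0
  have : (Set.Icc (fun _ => -⌈R⌉) (fun _ => ⌈R⌉) : Set (Fin d → ℤ)).Finite := Set.finite_Icc _ _
  refine (this.image (fun z : Fin d → ℤ => fun i => (z i : ℝ))).subset ?_
  rintro _ ⟨⟨z, rfl⟩, hz⟩
  refine ⟨z, ?_, rfl⟩
  have h1 := hR hz
  rw [mem_closedBall_zero_iff] at h1
  have h2 : ∀ i, |(z i : ℝ)| ≤ R := fun i => (norm_le_pi_norm (fun i => (z i : ℝ)) i).trans h1
  constructor
  · intro i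
    have := (abs_le.1 (h2 i)).1
    have h3 := Int.le_ceil R
    have : (-⌈R⌉ : ℝ) ≤ z i := by linarith
    exact_mod_cast this
  · intro i
    have := (abs_le.1 (h2 i)).2
    have h3 := Int.le_ceil R
    have : (z i : ℝ) ≤ ⌈R⌉ := by linarith
    exact_mod_cast this

lemma interior_count {d k : ℕ} (w : Fin d → Fin d → ℝ) (a : Fin d → ℝ)
    (hdet : (Matrix.of fun l i => w i l - a l).det ≠ 0)
    (hk : (latticePts d ∩ interior (convexHull ℝ (insert a (Set.range w)))).ncard = k)
    (Q : Finset (Fin d → ℝ)) (hQ : ∀ c ∈ Q, (∀ i, 0 < c i) ∧ ∑ i, c i < 1 ∧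
      a + ∑ i, c i • (w i - a) ∈ ILat (Fin d)) : Q.card ≤ k := by
  classical
  have hfin : (latticePts d ∩ interior (convexHull ℝ (insert a (Set.range w)))).Finite := by
    apply lat_finite
    have : IsCompact (convexHull ℝ (insert a (Set.range w))) :=
      ((Set.finite_range w).insert a).isCompact_convexHull (𝕜 := ℝ)
    exact this.isBounded.subset interior_subset
  have hinj : Function.Injective (fun c : Fin d → ℝ => a + ∑ i, c i • (w i - a)) := by
    intro c c' h
    simp only at h
    rw [← psi_point w a hdet c, h, psi_point w a hdet c']
  rw [← hk, ← Finset.card_image_of_injective Q hinj, ← Set.ncard_coe_finset]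
  apply Set.ncard_le_ncard _ hfin
  intro x hx
  simp only [Finset.coe_image, Set.mem_image] at hx
  obtain ⟨c, hc, rfl⟩ := hx
  obtain ⟨h1, h2, h3⟩ := hQ c hc
  exact ⟨h3, interior_of_pos w a hdet c h1 h2⟩

section FinalPart

variable {n : ℕ}

/-- scaled edge vectors from the last facet vertex -/
def uVec (w : Fin (n + 1) → Fin (n + 1) → ℝ) (i : Fin n) : Fin (n + 1) → ℝ :=
  (1 / (sylAux i : ℝ)) • (w i.castSucc - w (Fin.last n))

/-- lattice height of the apex -/
def hgt (n k : ℕ) : ℝ := ((k : ℝ) + 1) * ((sylAux n : ℝ) - 1)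

def gVec (k : ℕ) (w : Fin (n + 1) → Fin (n + 1) → ℝ) (a : Fin (n + 1) → ℝ) : Fin (n + 1) → ℝ :=
  (1 / hgt n k) • (a - w (Fin.last n))

def colVec (k : ℕ) (w : Fin (n + 1) → Fin (n + 1) → ℝ) (a : Fin (n + 1) → ℝ) :
    Fin (n + 1) → Fin (n + 1) → ℝ :=
  Fin.snoc (α := fun _ => Fin (n + 1) → ℝ) (uVec w) (gVec k w a)

def vtxVec (w : Fin (n + 1) → Fin (n + 1) → ℝ) (a : Fin (n + 1) → ℝ) :
    Fin (n + 1) → Fin (n + 1) → ℝ :=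
  Fin.snoc (α := fun _ => Fin (n + 1) → ℝ) (fun i => w i.castSucc) a

def sclVec (n k : ℕ) : Fin (n + 1) → ℝ :=
  Fin.snoc (α := fun _ => ℝ) (fun i : Fin n => (sylAux i : ℝ)) (hgt n k)

lemma hgt_pos (n k : ℕ) : 0 < hgt n k := by
  have := sylAux_real n
  have h2 : (0:ℝ) ≤ k := by positivity
  unfold hgt
  apply _root_.mul_pos <;> linarith

lemma sclVec_pos (n k : ℕ) (j : Fin (n + 1)) : 0 < sclVec n k j := by
  refine Fin.lastCases ?_ (fun i => ?_) j
  · simp [sclVec, hgt_pos]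
  · have := sylAux_real i
    simp only [sclVec, Fin.snoc_castSucc]
    linarith

lemma scl_col (k : ℕ) (w : Fin (n + 1) → Fin (n + 1) → ℝ) (a : Fin (n + 1) → ℝ) (j : Fin (n + 1)) :
    vtxVec w a j - w (Fin.last n) = sclVec n k j • colVec k w a j := by
  refine Fin.lastCases ?_ (fun i => ?_) j
  · have := (hgt_pos n k).ne'
    simp [vtxVec, sclVec, colVec, gVec, smul_smul, this]
  · have := sylAux_real i
    have : (sylAux i : ℝ) ≠ 0 := by linarith
    simp [vtxVec, sclVec, colVec, uVec, smul_smul, this]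

lemma scl_prod (n k : ℕ) : ∏ j, sclVec n k j = ((k : ℝ) + 1) * ((sylAux n : ℝ) - 1) ^ 2 := by
  rw [Fin.prod_univ_castSucc]
  simp only [sclVec, Fin.snoc_castSucc, Fin.snoc_last]
  rw [Fin.prod_univ_eq_prod_range (fun i => (sylAux i : ℝ)) n, sylAux_prod_real, hgt]
  ring

/-- matrix of the new lattice basis -/
def colMat (k : ℕ) (w : Fin (n + 1) → Fin (n + 1) → ℝ) (a : Fin (n + 1) → ℝ) :
    Matrix (Fin (n + 1)) (Fin (n + 1)) ℝ := Matrix.of fun l j => colVec k w a j l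

lemma colMat_mulVec (k : ℕ) (w : Fin (n + 1) → Fin (n + 1) → ℝ) (a : Fin (n + 1) → ℝ) (x : Fin (n + 1) → ℝ) :
    (colMat k w a).mulVec x = ∑ i : Fin n, x i.castSucc • uVec w i + x (Fin.last n) • gVec k w a := by
  ext l
  simp [colMat, Matrix.mulVec, dotProduct, Fin.sum_univ_castSucc, colVec, mul_comm]

lemma colMat_det (k : ℕ) (w : Fin (n + 1) → Fin (n + 1) → ℝ) (a : Fin (n + 1) → ℝ)
    (hdet : |(Matrix.of fun l j => vtxVec w a j l - w (Fin.last n) l).det|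
      = ((k : ℝ) + 1) * ((sylAux n : ℝ) - 1) ^ 2) : |(colMat k w a).det| = 1 := by
  have h1 : (Matrix.of fun l j => vtxVec w a j l - w (Fin.last n) l)
      = colMat k w a * Matrix.diagonal (sclVec n k) := by
    ext l j
    rw [Matrix.mul_diagonal]
    have := congrFun (scl_col k w a j) l
    simp only [Pi.sub_apply, Pi.smul_apply, smul_eq_mul] at this
    simp only [Matrix.of_apply, colMat, this, mul_comm]
  have hpos : 0 < ∏ j, sclVec n k j := Finset.prod_pos fun j _ => sclVec_pos n k j
  rw [h1, Matrix.det_mul, Matrix.det_diagonal, abs_mul, abs_of_pos hpos, ← scl_prod] at hdet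
  exact mul_right_cancel₀ hpos.ne' (by rw [hdet, one_mul])

lemma ilat_det {ι : Type*} [Fintype ι] [DecidableEq ι] (M : Matrix ι ι ℝ) (h : ∀ j, (fun l => M l j) ∈ ILat ι) :
    ∃ z : ℤ, M.det = z := by
  choose Z hZ using h
  refine ⟨(Matrix.of fun l j => Z j l).det, ?_⟩
  have : M = (Matrix.of fun l j => Z j l).map (Int.castRingHom ℝ) := by
    ext l j
    have := congrFun (hZ j) l
    simp at this
    simp [this]
  rw [this, ← RingHom.mapMatrix_apply, ← RingHom.map_det]
  rfl

/-- a coordinate of an integer vector w.r.t. a basis of determinant `±1` all of whose other vectors are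
integer is an integer -/
lemma coord_int {ι : Type*} [Fintype ι] [DecidableEq ι] (M : Matrix ι ι ℝ) (hdet : |M.det| = 1) (i : ι)
    (hM : ∀ j, j ≠ i → (fun l => M l j) ∈ ILat ι) (x : ι → ℝ) (hx : M.mulVec x ∈ ILat ι) :
    ∃ z : ℤ, x i = z := by
  have h1 : M.cramer (M.mulVec x) = M.det • x := by
    rw [Matrix.cramer_eq_adjugate_mulVec, Matrix.mulVec_mulVec, Matrix.adjugate_mul]
    simp [Matrix.smul_mulVec]
  have h2 := congrFun h1 i
  rw [Matrix.cramer_apply] at h2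
  obtain ⟨z, hz⟩ := ilat_det (M.updateCol i (M.mulVec x)) (by
    intro j
    by_cases hj : j = i
    · subst hj; simpa using hx
    · convert hM j hj using 2
      simp [hj])
  rw [hz] at h2
  simp only [Pi.smul_apply, smul_eq_mul] at h2
  rcases eq_or_eq_neg_of_abs_eq hdet with h | h
  · exact ⟨z, by rw [h] at h2; linarith⟩
  · exact ⟨-z, by rw [h] at h2; push_cast; linarith⟩

lemma vtx_range (w : Fin (n + 1) → Fin (n + 1) → ℝ) (a : Fin (n + 1) → ℝ) :
    insert a (Set.range w) = insert (w (Fin.last n)) (Set.range (vtxVec w a)) := by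
  ext x
  simp only [Set.mem_insert_iff, Set.mem_range]
  rw [Fin.exists_fin_succ', Fin.exists_fin_succ']
  simp only [vtxVec, Fin.snoc_castSucc, Fin.snoc_last]
  constructor
  · rintro (h | ⟨i, h⟩ | h)
    · exact Or.inr (Or.inr h.symm)
    · exact Or.inr (Or.inl ⟨i, h⟩)
    · exact Or.inl h.symm
  · rintro (h | ⟨i, h⟩ | h)
    · exact Or.inr (Or.inr h.symm)
    · exact Or.inr (Or.inl ⟨i, h⟩)
    · exact Or.inl h.symm

lemma final_map (k : ℕ) (w : Fin (n + 1) → Fin (n + 1) → ℝ) (a : Fin (n + 1) → ℝ)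
    (hw : ∀ i, w i ∈ ILat (Fin (n + 1)))
    (hdet : |(colMat k w a).det| = 1)
    (hu : ∀ i, uVec w i ∈ ILat (Fin (n + 1))) (hg : gVec k w a ∈ ILat (Fin (n + 1))) :
    ∃ φ : (Fin (n + 1) → ℝ) →ᵃ[ℝ] (Fin (n + 1) → ℝ),
      φ '' latticePts (n + 1) = latticePts (n + 1) ∧
      φ '' (convexHull ℝ (insert a (Set.range w))) = ZPW (n + 1) k := by
  set M := colMat k w a with hM
  have hMu : IsUnit M.det := isUnit_iff_ne_zero.2 (by intro h; rw [h] at hdet; simp at hdet)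
  have hcol : ∀ j, (fun l => M l j) ∈ ILat (Fin (n + 1)) := by
    intro j
    show colVec k w a j ∈ _
    refine Fin.lastCases ?_ (fun i => ?_) j
    · simpa [colVec] using hg
    · simpa [colVec] using hu i
  let φ : (Fin (n + 1) → ℝ) →ᵃ[ℝ] (Fin (n + 1) → ℝ) :=
    (Matrix.toLin' M⁻¹).toAffineMap - AffineMap.const ℝ _ (M⁻¹.mulVec (w (Fin.last n)))
  have hφ : ∀ x, φ x = M⁻¹.mulVec (x - w (Fin.last n)) := by
    intro x
    simp [φ, Matrix.mulVec_sub]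
  have hφ2 : ∀ y, φ (w (Fin.last n) + M.mulVec y) = y := by
    intro y
    rw [hφ, add_sub_cancel_left, Matrix.mulVec_mulVec, Matrix.nonsing_inv_mul _ hMu, Matrix.one_mulVec]
  refine ⟨φ, ?_, ?_⟩
  · apply Set.Subset.antisymm
    · rintro _ ⟨x, hx, rfl⟩
      have hx' : x - w (Fin.last n) ∈ ILat (Fin (n + 1)) := sub_mem hx (hw _)
      have : M.mulVec (φ x) = x - w (Fin.last n) := by
        rw [hφ, Matrix.mulVec_mulVec, Matrix.mul_nonsing_inv _ hMu, Matrix.one_mulVec]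
      rw [← this] at hx'
      have hz := fun i => coord_int M hdet i (fun j _ => hcol j) (φ x) hx'
      choose z hz using hz
      exact ⟨z, by ext i; exact (hz i).symm⟩
    · rintro x ⟨z, rfl⟩
      refine ⟨w (Fin.last n) + M.mulVec (fun i => (z i : ℝ)), ?_, hφ2 _⟩
      have : M.mulVec (fun i => (z i : ℝ)) = ∑ j, z j • (fun l => M l j) := by
        ext l
        simp [Matrix.mulVec, dotProduct, mul_comm]
      have h2 : w (Fin.last n) + M.mulVec (fun i => (z i : ℝ)) ∈ ILat (Fin (n + 1)) := by
        rw [this]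
        exact add_mem (hw _) (sum_mem fun j _ => zsmul_mem (hcol j) _)
      exact h2
  · rw [AffineMap.image_convexHull, vtx_range, Set.image_insert_eq, ← Set.range_comp, ZPW]
    have h0 : φ (w (Fin.last n)) = 0 := by rw [hφ]; simp
    rw [h0]
    congr 3
    funext j
    have : vtxVec w a j = w (Fin.last n) + M.mulVec (sclVec n k j • stdBasis (n + 1) j) := by
      have h1 := scl_col k w a j
      rw [sub_eq_iff_eq_add'] at h1
      rw [h1, Matrix.mulVec_smul, stdBasis, Matrix.mulVec_single_one]
      rfl
    simp only [Function.comp]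
    rw [this, hφ2]
    congr 1
    refine Fin.lastCases ?_ (fun i => ?_) j
    · simp [sclVec, hgt, syl]
    · simp [sclVec, syl]
      intro h
      exact absurd h (by have := i.2; omega)

end FinalPart

lemma syl_sum (n : ℕ) : ∑ i : Fin n, 1 / (sylAux i : ℝ) = 1 - 1 / ((sylAux n : ℝ) - 1) := by
  have h := ySeq_sum n 0 (Nat.zero_le n)
  rw [← Finset.range_eq_Ico, Finset.sum_range_succ] at h
  have h2 : ∑ i : Fin n, 1 / (sylAux i : ℝ) = ∑ l ∈ Finset.range n, ySeq n l := by
    rw [← Fin.sum_univ_eq_sum_range]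
    refine Finset.sum_congr rfl fun i _ => ?_
    simp [ySeq]
  rw [h2]
  simp only [ySeq, lt_irrefl, if_false] at h ⊢
  simp only [sylAux] at h
  norm_num at h
  simp only [one_div]
  linarith

lemma w_comb {n : ℕ} (w : Fin (n + 1) → Fin (n + 1) → ℝ) (c : Fin (n + 1) → ℝ) (hc : ∑ i, c i = 1) :
    ∑ i, c i • w i = w (Fin.last n) + ∑ i : Fin n, (c i.castSucc * sylAux i) • uVec w i := by
  have h1 := sum_one_point w (w (Fin.last n)) c hc
  rw [← h1, Fin.sum_univ_castSucc]
  simp only [sub_self, smul_zero, add_zero]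
  congr 1
  refine Finset.sum_congr rfl fun i _ => ?_
  have := sylAux_real i
  have h0 : (sylAux i : ℝ) ≠ 0 := by linarith
  rw [uVec, smul_smul]
  congr 1
  field_simp

lemma p_eq {n : ℕ} (w : Fin (n + 1) → Fin (n + 1) → ℝ) (β : Fin (n + 1) → ℝ) (hβ : ∀ i, β i = ySeq n i)
    (hβ1 : ∑ i, β i = 1) : ∑ i, β i • w i = w (Fin.last n) + ∑ i : Fin n, uVec w i := by
  rw [w_comb w β hβ1]
  congr 1
  refine Finset.sum_congr rfl fun i _ => ?_
  have := sylAux_real i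
  have h0 : (sylAux i : ℝ) ≠ 0 := by linarith
  rw [hβ]
  simp [ySeq, h0]

lemma u_int {n : ℕ} (w : Fin (n + 1) → Fin (n + 1) → ℝ) (hw : ∀ i, w i ∈ ILat (Fin (n + 1)))
    (β : Fin (n + 1) → ℝ) (hβ : ∀ i, β i = ySeq n i) (hβ1 : ∑ i, β i = 1)
    (hp : ∑ i, β i • w i ∈ ILat (Fin (n + 1))) (i : Fin n) : uVec w i ∈ ILat (Fin (n + 1)) := by
  classical
  rw [p_eq w β hβ hβ1] at hp
  have hp' : ∑ i : Fin n, uVec w i ∈ ILat (Fin (n + 1)) := by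
    have := sub_mem hp (hw (Fin.last n))
    simpa using this
  have hs : ∀ l : Fin n, (sylAux l : ℤ) • uVec w l ∈ ILat (Fin (n + 1)) := by
    intro l
    have := sylAux_real l
    have h0 : (sylAux l : ℝ) ≠ 0 := by linarith
    have : (sylAux l : ℤ) • uVec w l = w l.castSucc - w (Fin.last n) := by
      ext j
      simp [uVec, h0]
    rw [this]
    exact sub_mem (hw _) (hw _)
  let q : ℕ := ∏ l ∈ Finset.univ.erase i, sylAux (l : Fin n)
  have hq : (q : ℤ) • uVec w i ∈ ILat (Fin (n + 1)) := by
    have e : (q : ℤ) • uVec w i = (q : ℤ) • ∑ l, uVec w l - ∑ l ∈ Finset.univ.erase i, (q : ℤ) • uVec w l := by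
      rw [← Finset.smul_sum, ← smul_sub, ← Finset.add_sum_erase _ _ (Finset.mem_univ i), add_sub_cancel_right]
    rw [e]
    refine sub_mem (zsmul_mem hp' _) (sum_mem fun l hl => ?_)
    obtain ⟨r, hr⟩ : sylAux l ∣ q := Finset.dvd_prod_of_mem (fun l : Fin n => sylAux l) hl
    rw [hr, Nat.cast_mul, mul_comm, mul_smul]
    exact zsmul_mem (hs l) _
  have hcop : Nat.Coprime (sylAux i) q := by
    apply Nat.Coprime.prod_right
    intro l hl
    apply sylAux_coprime
    intro h
    simp at hl
    exact hl (Fin.ext h.symm)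
  obtain ⟨x, y, hxy⟩ := Nat.isCoprime_iff_coprime.2 hcop
  have : uVec w i = x • ((sylAux i : ℤ) • uVec w i) + y • ((q : ℤ) • uVec w i) := by
    rw [smul_smul, smul_smul, ← add_smul, hxy, one_smul]
  rw [this]
  exact add_mem (zsmul_mem (hs i) _) (zsmul_mem hq _)

lemma level_one {n k : ℕ} (w : Fin (n + 1) → Fin (n + 1) → ℝ) (a : Fin (n + 1) → ℝ)
    (β : Fin (n + 1) → ℝ) (hβ : ∀ i, β i = ySeq n i) (hβ1 : ∑ i, β i = 1)
    (hp : ∑ i, β i • w i ∈ ILat (Fin (n + 1)))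
    (hU : ∀ c : Fin (n + 1) → ℝ, (∀ i, 0 < c i) → ∑ i, c i = 1 →
      ∑ i, c i • w i ∈ ILat (Fin (n + 1)) → c = β)
    (hdet : |(colMat k w a).det| = 1)
    (hu : ∀ i, uVec w i ∈ ILat (Fin (n + 1))) :
    ∃ f : Fin n → ℝ, ∑ i, f i • uVec w i + gVec k w a ∈ ILat (Fin (n + 1)) := by
  obtain ⟨t, htinj, htL, htb⟩ := blich (colMat k w a)
    (Fin.snoc (α := fun _ => ℝ) (fun _ : Fin n => (1:ℝ)) 2) (by
      intro j
      refine Fin.lastCases ?_ (fun i => ?_) j <;> simp) 1 (by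
      rw [hdet, Fin.prod_univ_castSucc]; simp)
  have hL := htL 0 1
  set τ := t 0 - t 1 with hτ
  have hτ0 : τ ≠ 0 := by
    intro h0
    have := htinj (sub_eq_zero.1 h0)
    simp at this
  have hb1 : ∀ i : Fin n, |τ i.castSucc| < 1 := fun i => by
    have h := htb 0 1 i.castSucc
    simp only [Fin.snoc_castSucc] at h; exact h
  have hb2 : |τ (Fin.last n)| < 2 := by
    have h := htb 0 1 (Fin.last n)
    simp only [Fin.snoc_last] at h; exact h
  obtain ⟨z, hz⟩ := coord_int (colMat k w a) hdet (Fin.last n) (by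
    intro j
    refine Fin.lastCases ?_ (fun i => ?_) j
    · simp
    · intro _
      show colVec k w a i.castSucc ∈ _
      simpa [colVec] using hu i) τ hL
  rw [colMat_mulVec] at hL
  rw [hz] at hb2 hL
  have hz2 : |z| < 2 := by exact_mod_cast hb2
  rw [abs_lt] at hz2
  have hcases : z = 0 ∨ z = 1 ∨ z = -1 := by omega
  rcases hcases with rfl | rfl | rfl
  · exfalso
    simp only [Int.cast_zero, zero_smul, add_zero] at hL
    have key : ∀ δ : Fin n → ℝ, (∀ i, |δ i| < 1) → 0 ≤ ∑ i, δ i / sylAux i →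
        ∑ i, δ i • uVec w i ∈ ILat (Fin (n + 1)) → δ = 0 := by
      intro δ hδ hδs hδL
      let c : Fin (n + 1) → ℝ := Fin.snoc (α := fun _ => ℝ) (fun i : Fin n => (1 - δ i) / sylAux i)
        (1 / ((sylAux n : ℝ) - 1) + ∑ i, δ i / sylAux i)
      have hN := sylAux_real n
      have hsum : ∑ i, c i = 1 := by
        rw [Fin.sum_univ_castSucc]
        simp only [c, Fin.snoc_castSucc, Fin.snoc_last, sub_div, Finset.sum_sub_distrib, syl_sum]
        ring
      have hc := hU c ?_ hsum ?_
      · ext i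
        have := congrFun hc i.castSucc
        rw [hβ] at this
        simp [c, ySeq] at this
        have h2 := sylAux_real i
        have h0 : (sylAux i : ℝ) ≠ 0 := by linarith
        field_simp at this
        simp; linarith
      · intro j
        refine Fin.lastCases ?_ (fun i => ?_) j
        · simp only [c, Fin.snoc_last]
          have : 0 < 1 / ((sylAux n : ℝ) - 1) := one_div_pos.2 (by linarith)
          linarith
        · simp only [c, Fin.snoc_castSucc]
          have h2 := sylAux_real i
          apply div_pos
          · linarith [(abs_lt.1 (hδ i)).2]
          · linarith
      · rw [w_comb w c hsum]
        have := sub_mem hp hδL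
        rw [p_eq w β hβ hβ1] at this
        convert this using 1
        rw [add_sub_assoc, ← Finset.sum_sub_distrib]
        congr 1
        refine Finset.sum_congr rfl fun i _ => ?_
        have h2 := sylAux_real i
        have h0 : (sylAux i : ℝ) ≠ 0 := by linarith
        simp only [c, Fin.snoc_castSucc]
        rw [div_mul_cancel₀ _ h0, sub_smul, one_smul]
    apply hτ0
    have hδ0 : (fun i : Fin n => τ i.castSucc) = 0 := by
      rcases le_total 0 (∑ i : Fin n, τ i.castSucc / sylAux i) with h | h
      · exact key _ hb1 h hL
      · have := key (fun i => - τ i.castSucc) (fun i => by rw [abs_neg]; exact hb1 i) (by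
          simp only [neg_div, Finset.sum_neg_distrib]; linarith) (by
          have := neg_mem hL
          simpa only [neg_smul, Finset.sum_neg_distrib] using this)
        ext i
        have := congrFun this i
        simpa using this
    ext j
    refine Fin.lastCases ?_ (fun i => ?_) j
    · simpa using hz
    · exact congrFun hδ0 i
  · exact ⟨_, by simpa using hL⟩
  · refine ⟨fun i => - τ i.castSucc, ?_⟩
    have := neg_mem hL
    simpa [neg_smul, Finset.sum_neg_distrib, add_comm] using this

lemma g_int {n k : ℕ} (w : Fin (n + 1) → Fin (n + 1) → ℝ) (a : Fin (n + 1) → ℝ)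
    (hw : ∀ i, w i ∈ ILat (Fin (n + 1)))
    (hI : ∀ Q : Finset (Fin (n + 1) → ℝ), (∀ c ∈ Q, (∀ i, 0 < c i) ∧ ∑ i, c i < 1 ∧
      a + ∑ i, c i • (w i - a) ∈ ILat (Fin (n + 1))) → Q.card ≤ k)
    (hu : ∀ i, uVec w i ∈ ILat (Fin (n + 1)))
    (f : Fin n → ℝ) (hf : ∑ i, f i • uVec w i + gVec k w a ∈ ILat (Fin (n + 1))) :
    gVec k w a ∈ ILat (Fin (n + 1)) ∨
      (n = 1 ∧ (1 / hgt n k) • (a - w 0) ∈ ILat (Fin (n + 1))) := by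
  classical
  have hh := hgt_pos n k
  have hN := sylAux_real n
  have hs : ∀ i : Fin n, (0:ℝ) < sylAux i := fun i => by have := sylAux_real i; linarith
  have hNi : 0 < 1 / ((sylAux n : ℝ) - 1) := one_div_pos.2 (by linarith)
  have hk0 : (0:ℝ) < (k:ℝ) + 1 := by positivity
  have hhN : 1 / ((sylAux n : ℝ) - 1) = ((k : ℝ) + 1) / hgt n k := by
    unfold hgt
    have : (sylAux n : ℝ) - 1 ≠ 0 := by linarith
    field_simp
  let r : ℕ → Fin n → ℝ := fun t i => ⌈(t : ℝ) * f i⌉ - t * f i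
  have hr0 : ∀ t i, 0 ≤ r t i := fun t i => by
    have := Int.le_ceil ((t : ℝ) * f i)
    simp only [r]; linarith
  have hr1 : ∀ t i, r t i < 1 := fun t i => by
    have := Int.ceil_lt_add_one ((t : ℝ) * f i)
    simp only [r]; linarith
  let c : ℕ → Fin (n + 1) → ℝ := fun t => Fin.snoc (α := fun _ => ℝ)
    (fun i : Fin n => (1 - r t i) / sylAux i)
    (((k : ℝ) + 1) / hgt n k + ∑ i, r t i / sylAux i - t / hgt n k)
  have hcsum : ∀ t, ∑ j, c t j = 1 - t / hgt n k := by
    intro t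
    rw [Fin.sum_univ_castSucc]
    simp only [c, Fin.snoc_castSucc, Fin.snoc_last, sub_div, Finset.sum_sub_distrib, syl_sum]
    rw [hhN]
    ring
  have hcinj : Function.Injective c := by
    intro t t' h
    have h1 := hcsum t
    rw [h, hcsum t'] at h1
    have : (t : ℝ) / hgt n k = t' / hgt n k := by linarith
    rw [div_left_inj' hh.ne'] at this
    exact_mod_cast this
  have hcpos : ∀ t : ℕ, (t : ℝ) / hgt n k < ((k : ℝ) + 1) / hgt n k + ∑ i, r t i / sylAux i → ∀ j, 0 < c t j := by
    intro t ht j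
    refine Fin.lastCases ?_ (fun i => ?_) j
    · simp only [c, Fin.snoc_last]; linarith
    · simp only [c, Fin.snoc_castSucc]
      exact div_pos (by linarith [hr1 t i]) (hs i)
  have hcL : ∀ t : ℕ, a + ∑ j, c t j • (w j - a) ∈ ILat (Fin (n + 1)) := by
    intro t
    have e : a + ∑ j, c t j • (w j - a) = w (Fin.last n) + (t : ℤ) • (∑ i, f i • uVec w i + gVec k w a)
        + ∑ i, (1 - ⌈(t : ℝ) * f i⌉) • uVec w i := by
      have e1 : ∑ j, c t j • (w j - a) = ∑ j, c t j • (w j - w (Fin.last n)) + (∑ j, c t j) • (w (Fin.last n) - a) := by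
        rw [Finset.sum_smul, ← Finset.sum_add_distrib]
        refine Finset.sum_congr rfl fun j _ => ?_
        rw [← smul_add]; congr 1; abel
      have e2 : ∑ j, c t j • (w j - w (Fin.last n)) = ∑ i, (1 - r t i) • uVec w i := by
        rw [Fin.sum_univ_castSucc]
        simp only [sub_self, smul_zero, add_zero]
        refine Finset.sum_congr rfl fun i _ => ?_
        simp only [c, Fin.snoc_castSucc, uVec, smul_smul]
        congr 1
        ring
      have e3 : ∑ i, (1 - r t i) • uVec w i = (t : ℝ) • ∑ i, f i • uVec w i + ∑ i, (1 - ⌈(t : ℝ) * f i⌉) • uVec w i := by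
        rw [Finset.smul_sum, ← Finset.sum_add_distrib]
        refine Finset.sum_congr rfl fun i _ => ?_
        ext l
        simp [r]
        ring
      rw [e1, e2, e3, hcsum]
      ext l
      simp only [gVec, Pi.add_apply, Pi.smul_apply, smul_eq_mul, Pi.sub_apply, zsmul_eq_mul]
      simp
      ring
    rw [e]
    exact add_mem (add_mem (hw _) (zsmul_mem hf _)) (sum_mem fun i _ => zsmul_mem (hu i) _)
  have hrs : ∀ t, 0 ≤ ∑ i, r t i / sylAux i := fun t =>
    Finset.sum_nonneg fun i _ => div_nonneg (hr0 t i) (hs i).le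
  have key : ∀ t : ℕ, k + 1 ≤ t → ∑ i, r t i / sylAux i ≤ (t : ℝ) / hgt n k - ((k : ℝ) + 1) / hgt n k := by
    intro t ht
    by_contra hlt
    push Not at hlt
    have hcard := hI ((insert t (Finset.Icc 1 k)).image c) ?_
    · rw [Finset.card_image_of_injective _ hcinj, Finset.card_insert_of_notMem (by simp; omega)] at hcard
      simp at hcard
    · intro c' hc'
      simp only [Finset.mem_image, Finset.mem_insert, Finset.mem_Icc] at hc'
      obtain ⟨t', ht', rfl⟩ := hc'
      have ht'1 : 1 ≤ t' := by omega
      refine ⟨hcpos t' ?_, ?_, hcL t'⟩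
      · rcases ht' with rfl | ⟨_, h2⟩
        · linarith
        · have h3 : (t' : ℝ) / hgt n k < ((k : ℝ) + 1) / hgt n k := by
            rw [div_lt_div_iff_of_pos_right hh]
            have : (t' : ℝ) ≤ k := by exact_mod_cast h2
            linarith
          linarith [hrs t']
      · rw [hcsum]
        have : (0:ℝ) < t' / hgt n k := div_pos (by exact_mod_cast ht'1) hh
        linarith
  -- level k + 1
  have hA : ∀ i, r (k + 1) i = 0 := by
    have h1 := key (k + 1) le_rfl
    push_cast at h1
    rw [sub_self] at h1
    have h2 := (Finset.sum_eq_zero_iff_of_nonneg (fun i _ => div_nonneg (hr0 (k + 1) i) (hs i).le)).1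
      (le_antisymm h1 (hrs (k + 1)))
    intro i
    have := h2 i (Finset.mem_univ _)
    rw [_root_.div_eq_zero_iff] at this
    exact this.resolve_right (hs i).ne'
  have hB := key (k + 2) (by omega)
  have hB' : ∀ i, r (k + 2) i / sylAux i ≤ 1 / hgt n k := by
    intro i
    have h1 := Finset.single_le_sum (fun i _ => div_nonneg (hr0 (k + 2) i) (hs i).le) (Finset.mem_univ i)
    refine (h1.trans hB).trans (le_of_eq ?_)
    push_cast
    rw [← sub_div]
    congr 1
    ring
  have hfeq : ∀ i, f i = (⌈((k + 2 : ℕ) : ℝ) * f i⌉ : ℝ) - ⌈((k + 1 : ℕ) : ℝ) * f i⌉ - r (k + 2) i := by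
    intro i
    have := hA i
    simp only [r] at this ⊢
    push_cast at this ⊢
    linarith
  have hR : ∀ i, ∃ R : ℤ, ((k : ℝ) + 1) * r (k + 2) i = R := by
    intro i
    refine ⟨(k + 1) * (⌈((k + 2 : ℕ) : ℝ) * f i⌉ - ⌈((k + 1 : ℕ) : ℝ) * f i⌉) - ⌈((k + 1 : ℕ) : ℝ) * f i⌉, ?_⟩
    have h1 := hfeq i
    have h2 := hA i
    simp only [r] at h2
    have h3 : ((k : ℝ) + 1) * f i = ⌈((k + 1 : ℕ) : ℝ) * f i⌉ := by
      push_cast at h2 ⊢; linarith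
    have h4 : r (k + 2) i = (⌈((k + 2 : ℕ) : ℝ) * f i⌉ : ℝ) - ⌈((k + 1 : ℕ) : ℝ) * f i⌉ - f i := by linarith
    rw [h4, mul_sub, h3]
    push_cast
    ring
  have hN2 : ∀ i, r (k + 2) i ≠ 0 → ((sylAux n : ℝ) - 1) * (((k : ℝ) + 1) * r (k + 2) i) ≤ sylAux i := by
    intro i _
    have h1 := hB' i
    rw [div_le_div_iff₀ (hs i) hh, hgt] at h1
    linarith
  by_cases hall : ∀ i, r (k + 2) i = 0
  · left
    have e : gVec k w a = (∑ i, f i • uVec w i + gVec k w a)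
        - ∑ i, (⌈((k + 2 : ℕ) : ℝ) * f i⌉ - ⌈((k + 1 : ℕ) : ℝ) * f i⌉) • uVec w i := by
      have : ∑ i, f i • uVec w i = ∑ i, (⌈((k + 2 : ℕ) : ℝ) * f i⌉ - ⌈((k + 1 : ℕ) : ℝ) * f i⌉) • uVec w i := by
        refine Finset.sum_congr rfl fun i _ => ?_
        have h1 := hfeq i
        rw [hall i, sub_zero] at h1
        nth_rewrite 1 [h1]
        ext l; simp
      rw [← this, add_sub_cancel_left]
    rw [e]
    exact sub_mem hf (sum_mem fun i _ => zsmul_mem (hu i) _)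
  · right
    push Not at hall
    obtain ⟨i, hi⟩ := hall
    obtain ⟨R, hReq⟩ := hR i
    have hRpos : (0:ℝ) < R := by
      rw [← hReq]
      exact _root_.mul_pos hk0 (lt_of_le_of_ne (hr0 _ _) (Ne.symm hi))
    have hR1 : 1 ≤ R := by
      have : 0 < R := by exact_mod_cast hRpos
      omega
    have hR1' : (1:ℝ) ≤ R := by exact_mod_cast hR1
    have h2 := hN2 i hi
    rw [hReq] at h2
    have hn1 : n = 1 := by
      by_contra hne
      have hi2 := i.2
      obtain ⟨l, hl⟩ : ∃ l : Fin n, l ≠ i := by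
        by_cases h0 : i.1 = 0
        · exact ⟨⟨1, by omega⟩, by intro h; have := congrArg Fin.val h; simp at this; omega⟩
        · exact ⟨⟨0, by omega⟩, by intro h; have := congrArg Fin.val h; simp at this; omega⟩
      have hdvd : (sylAux i * sylAux l) ∣ sylAux n - 1 := by
        apply Nat.Coprime.mul_dvd_of_dvd_of_dvd
        · exact sylAux_coprime (fun h => hl (Fin.ext h.symm))
        · rw [← sylAux_prod]; exact Finset.dvd_prod_of_mem _ (by simp)
        · rw [← sylAux_prod]; exact Finset.dvd_prod_of_mem _ (by simp)
      have h3 := sylAux_ge n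
      have h4 := Nat.le_of_dvd (by omega) hdvd
      have h5 : (sylAux i : ℝ) * sylAux l ≤ sylAux n - 1 := by
        have : ((sylAux i * sylAux l : ℕ) : ℝ) ≤ ((sylAux n - 1 : ℕ) : ℝ) := by exact_mod_cast h4
        rw [Nat.cast_sub (by omega)] at this
        push_cast at this
        exact this
      have h6 := sylAux_real l
      have h7 := sylAux_real i
      nlinarith
    refine ⟨hn1, ?_⟩
    subst hn1
    obtain rfl : i = 0 := Subsingleton.elim _ _
    have hsy : (sylAux 1 : ℝ) = 3 := by simp [sylAux]
    have hsy0 : (sylAux 0 : ℝ) = 2 := by simp [sylAux]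
    have hR2 : (R : ℝ) = 1 := by
      rw [hsy] at h2
      simp only [Fin.val_zero, hsy0] at h2
      linarith
    rw [hR2] at hReq
    have h8 := hfeq 0
    have e : (1 / hgt 1 k) • (a - w 0) = (∑ i, f i • uVec w i + gVec k w a)
        - (⌈((k + 2 : ℕ) : ℝ) * f 0⌉ - ⌈((k + 1 : ℕ) : ℝ) * f 0⌉) • uVec w 0 := by
      have h9 : r (k + 2) 0 = 1 / ((k : ℝ) + 1) := by
        field_simp; linarith
      rw [h9] at h8
      have h10 : (⌈((k + 2 : ℕ) : ℝ) * f 0⌉ : ℝ) - ⌈((k + 1 : ℕ) : ℝ) * f 0⌉ = f 0 + 1 / ((k : ℝ) + 1) := by linarith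
      ext l
      simp only [Fin.sum_univ_one, Pi.sub_apply, Pi.add_apply, Pi.smul_apply, smul_eq_mul, zsmul_eq_mul,
        Int.cast_sub, gVec, uVec, Fin.val_zero, hsy0, hgt, hsy]
      rw [Pi.mul_apply]
      simp only [Pi.sub_apply, Pi.intCast_apply, Pi.smul_apply, smul_eq_mul]
      rw [h10, show (Fin.castSucc (0 : Fin 1)) = 0 from rfl]
      field_simp
      ring
    rw [e]
    exact sub_mem hf (zsmul_mem (hu 0) _)

lemma det_of_vol {n k : ℕ} (b : Fin (n + 1) → ℝ) (c : Fin (n + 1) → Fin (n + 1) → ℝ)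
    (heq : volume (convexHull ℝ (insert b (Set.range c))) =
      ENNReal.ofReal ((1 / ((n + 1).factorial : ℝ)) * ((k : ℝ) + 1) * ((sylAux n : ℝ) - 1) ^ 2)) :
    |(Matrix.of fun l i => c i l - b l).det| = ((k : ℝ) + 1) * ((sylAux n : ℝ) - 1) ^ 2 := by
  rw [volume_simplex] at heq
  have hf : (0 : ℝ) < ((n + 1).factorial : ℝ) := by exact_mod_cast Nat.factorial_pos _
  have hk0 : (0 : ℝ) ≤ k := Nat.cast_nonneg k
  rw [ENNReal.ofReal_eq_ofReal_iff (by positivity) (by positivity)] at heq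
  field_simp at heq
  linarith

lemma main_sorted {n k : ℕ} (w : Fin (n + 1) → Fin (n + 1) → ℝ) (a : Fin (n + 1) → ℝ)
    (hw : ∀ i, w i ∈ ILat (Fin (n + 1)))
    (heq : volume (convexHull ℝ (insert a (Set.range w))) =
      ENNReal.ofReal ((1 / ((n + 1).factorial : ℝ)) * ((k : ℝ) + 1) * ((sylAux n : ℝ) - 1) ^ 2))
    (hI : ∀ Q : Finset (Fin (n + 1) → ℝ), (∀ c ∈ Q, (∀ i, 0 < c i) ∧ ∑ i, c i < 1 ∧
      a + ∑ i, c i • (w i - a) ∈ ILat (Fin (n + 1))) → Q.card ≤ k)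
    (β : Fin (n + 1) → ℝ) (hβ0 : ∀ i, 0 < β i) (hβ1 : ∑ i, β i = 1)
    (hp : ∑ i, β i • w i ∈ ILat (Fin (n + 1)))
    (hU : ∀ c : Fin (n + 1) → ℝ, (∀ i, 0 < c i) → ∑ i, c i = 1 →
      ∑ i, c i • w i ∈ ILat (Fin (n + 1)) → c = β)
    (hanti : Antitone β) :
    ∃ φ : (Fin (n + 1) → ℝ) →ᵃ[ℝ] (Fin (n + 1) → ℝ),
      φ '' latticePts (n + 1) = latticePts (n + 1) ∧
      φ '' (convexHull ℝ (insert a (Set.range w))) = ZPW (n + 1) k := by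
  classical
  have hk0 : (0 : ℝ) ≤ k := Nat.cast_nonneg k
  have hβ : ∀ i, β i = ySeq n i := by
    set x : ℕ → ℝ := fun i => if h : i < n + 1 then β ⟨i, h⟩ else 0 with hx
    have hxb : ∀ i : Fin (n + 1), x i = β i := fun i => by simp only [hx, i.2, dif_pos]
    have hprod : ∏ i ∈ Finset.range (n + 1), x i = ∏ i, β i := by
      rw [Finset.prod_range]; exact Finset.prod_congr rfl fun i _ => hxb i
    have hsum : ∑ i ∈ Finset.range (n + 1), x i = ∑ i, β i := by
      rw [Finset.sum_range]; exact Finset.sum_congr rfl fun i _ => hxb i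
    have key := syl_unique n x
      (fun i hi => by simp only [hx, hi, dif_pos]; exact hβ0 _)
      (fun i hi => by
        have : i < n + 1 := by omega
        simp only [hx, hi, this, dif_pos]
        apply hanti
        simp [Fin.le_def])
      (fun j hj => by
        have h := prodsum w hw β hβ0 hβ1 hp hU (Finset.univ.filter fun i => i.1 < j)
          ⟨⟨j, hj⟩, by simp⟩
        have e1 : ∏ l ∈ Finset.range j, x l = ∏ i ∈ Finset.univ.filter (fun i : Fin (n + 1) => i.1 < j), β i := by
          symm
          refine Finset.prod_bij (fun i _ => i.1) ?_ ?_ ?_ ?_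
          · intro i hi; simpa using hi
          · intro i _ i' _ h; exact Fin.ext h
          · intro l hl
            have hl' := Finset.mem_range.1 hl
            exact ⟨⟨l, by omega⟩, by simpa using hl', rfl⟩
          · intro i _; exact (hxb i).symm
        have e2 : ∑ l ∈ Finset.Ico j (n + 1), x l = ∑ i ∈ (Finset.univ.filter (fun i : Fin (n + 1) => i.1 < j))ᶜ, β i := by
          symm
          refine Finset.sum_bij (fun i _ => i.1) ?_ ?_ ?_ ?_
          · intro i hi
            simp at hi
            simp [hi, i.2]
          · intro i _ i' _ h; exact Fin.ext h
          · intro l hl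
            have hl' := Finset.mem_Ico.1 hl
            exact ⟨⟨l, by omega⟩, by simpa using hl'.1, rfl⟩
          · intro i _; exact (hxb i).symm
        rw [e1, e2]; exact h)
      (by rw [hsum, hβ1])
      (by
        rw [hprod]
        have h := volbound w a β hβ0 hβ1 hp hU hI
        rw [det_of_vol a w heq] at h
        have hk1 : (0 : ℝ) < k + 1 := by linarith
        refine le_of_mul_le_mul_left ?_ hk1
        linarith)
    intro i
    rw [← hxb i]; exact key i i.2
  have hu : ∀ i, uVec w i ∈ ILat (Fin (n + 1)) := u_int w hw β hβ hβ1 hp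
  have hdet : |(colMat k w a).det| = 1 := by
    apply colMat_det
    apply det_of_vol
    rw [← vtx_range]; exact heq
  obtain ⟨f, hf⟩ := level_one w a β hβ hβ1 hp hU hdet hu
  rcases g_int w a hw hI hu f hf with hg | ⟨rfl, hg⟩
  · exact final_map k w a hw hdet hu hg
  · have hr : Set.range (w ∘ Equiv.swap (0 : Fin 2) 1) = Set.range w :=
      (Equiv.swap (0 : Fin 2) 1).surjective.range_comp w
    have := final_map k (w ∘ Equiv.swap (0 : Fin 2) 1) a (fun i => hw _)
      (by
        apply colMat_det
        apply det_of_vol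
        rw [← vtx_range, hr]; exact heq)
      (by
        intro i
        have e : uVec (w ∘ Equiv.swap (0 : Fin 2) 1) i = - uVec w i := by
          obtain rfl : i = 0 := Subsingleton.elim _ _
          unfold uVec
          rw [← smul_neg, neg_sub]
          rfl
        rw [e]; exact neg_mem (hu i))
      (by exact hg)
    rw [hr] at this
    exact this

/-- Main result (uniqueness part): for `d ≥ 2` and `k ≥ 0`, if a `d`-dimensional
lattice simplex `S` with exactly `k` interior lattice points having a facet with exactly one
lattice point in its relative interior satisfies `vol S = (1/d!)(k+1)(s_d - 1)^2`, then
there is a unimodular transformation (an affine map `φ` of `ℝ^d` with `φ(ℤ^d) = ℤ^d`)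
mapping `S` onto `S_{d,k}`. -/
theorem volume_maximizer_in_Sdk1_unique
    (d k : ℕ) (hd : 2 ≤ d)
    (v : Fin (d + 1) → (Fin d → ℝ)) (hv : AffineIndependent ℝ v)
    (hvlat : ∀ i, v i ∈ latticePts d)
    (S : Set (Fin d → ℝ)) (hS : S = convexHull ℝ (Set.range v))
    (hk : (latticePts d ∩ interior S).ncard = k)
    (hfacet : ∃ i0 : Fin (d + 1),
      (latticePts d ∩ intrinsicInterior ℝ (convexHull ℝ (v '' {i | i ≠ i0}))).ncard = 1)
    (heq : volume S =
      ENNReal.ofReal ((1 / (d.factorial : ℝ)) * ((k : ℝ) + 1) * ((syl d : ℝ) - 1) ^ 2)) :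
    ∃ φ : (Fin d → ℝ) →ᵃ[ℝ] (Fin d → ℝ),
      φ '' latticePts d = latticePts d ∧ φ '' S = ZPW d k := by
  classical
  obtain ⟨n, rfl⟩ : ∃ n, d = n + 1 := ⟨d - 1, by omega⟩
  obtain ⟨i0, hi0⟩ := hfacet
  have hsyl : syl (n + 1) = sylAux n := rfl
  rw [hsyl] at heq
  set a := v i0 with ha
  set w0 : Fin (n + 1) → Fin (n + 1) → ℝ := v ∘ i0.succAbove with hw0
  have hr0 : v '' {i | i ≠ i0} = Set.range w0 := by
    rw [hw0, Set.range_comp, Fin.range_succAbove]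
    rfl
  have hrv : Set.range v = insert a (Set.range w0) := by
    rw [← hr0, ha, ← Set.image_insert_eq, ← Set.image_univ]
    congr 1
    ext i
    simp [em]
  rw [hrv] at hS
  rw [hr0] at hi0
  subst hS
  have hk0 : (0 : ℝ) ≤ k := Nat.cast_nonneg k
  have hs2 := sylAux_real n
  have hdet0 : (Matrix.of fun l i => w0 i l - a l).det ≠ 0 := by
    intro h
    have h1 := det_of_vol a w0 heq
    rw [h, abs_zero] at h1
    have : (0 : ℝ) < ((k : ℝ) + 1) * ((sylAux n : ℝ) - 1) ^ 2 :=
      _root_.mul_pos (by linarith) (pow_pos (by linarith) 2)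
    linarith
  obtain ⟨p, hp⟩ := Set.ncard_eq_one.1 hi0
  have hpm : p ∈ latticePts (n + 1) ∩ intrinsicInterior ℝ (convexHull ℝ (Set.range w0)) := by
    rw [hp]; rfl
  let σ : Equiv.Perm (Fin (n + 1)) := Tuple.sort (fun i => - psi w0 a p i)
  have hσ : Monotone ((fun i => - psi w0 a p i) ∘ σ) := Tuple.monotone_sort _
  obtain ⟨hb0, hb1⟩ := pos_of_relint w0 a hdet0 p hpm.2
  have hpe : ∑ i, psi w0 a p i • w0 i = p := by
    rw [← sum_one_point w0 a _ hb1]; exact psi_spec w0 a hdet0 p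
  have hr : Set.range (w0 ∘ σ) = Set.range w0 := σ.surjective.range_comp w0
  have hdetσ : (Matrix.of fun l i => (w0 ∘ σ) i l - a l).det ≠ 0 := by
    intro h
    have h1 := det_of_vol (k := k) a (w0 ∘ σ) (by rw [hr]; exact heq)
    rw [h, abs_zero] at h1
    have : (0 : ℝ) < ((k : ℝ) + 1) * ((sylAux n : ℝ) - 1) ^ 2 :=
      _root_.mul_pos (by linarith) (pow_pos (by linarith) 2)
    linarith
  have hpσ : ∑ i, psi w0 a p (σ i) • w0 (σ i) = p :=
    (Equiv.sum_comp σ fun i => psi w0 a p i • w0 i).trans hpe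
  have hb1σ : ∑ i, psi w0 a p (σ i) = 1 := (Equiv.sum_comp σ fun i => psi w0 a p i).trans hb1
  have main := main_sorted (k := k) (w0 ∘ σ) a (fun i => hvlat _) (by rw [hr]; exact heq)
    (interior_count (w0 ∘ σ) a hdetσ (by rw [hr]; exact hk))
    (fun i => psi w0 a p (σ i)) (fun i => hb0 _) hb1σ
    (by
      have : ∑ i, psi w0 a p (σ i) • (w0 ∘ σ) i = p := hpσ
      rw [this]; exact hpm.1)
    (by
      intro c hc hc1 hcl
      have h1 := relint_of_pos (w0 ∘ σ) a hdetσ c hc hc1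
      rw [hr] at h1
      have h2 : ∑ i, c i • (w0 ∘ σ) i ∈ ({p} : Set (Fin (n + 1) → ℝ)) := by
        rw [← hp]; exact ⟨hcl, h1⟩
      have h3 : ∑ i, c i • (w0 ∘ σ) i = p := h2
      have h4 := psi_point (w0 ∘ σ) a hdetσ c
      have h5 := psi_point (w0 ∘ σ) a hdetσ (fun i => psi w0 a p (σ i))
      rw [sum_one_point _ _ _ hc1, h3] at h4
      rw [sum_one_point _ _ _ hb1σ] at h5
      have h6 : ∑ i, psi w0 a p (σ i) • (w0 ∘ σ) i = p := hpσ
      rw [h6] at h5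
      exact h4.symm.trans h5)
    (fun i j hij => by have := hσ hij; simpa using this)
  rw [hr] at main
  exact main
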